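/- arXiv:2104.13045 — 2 statements merged into one kernel-verified Lean document; each statement's English description precedes it below -/
import Mathlib

section
/- Let f, g : ℝ → ℝ be smooth functions. Then for every integer k ≥ 1 and every t ∈ ℝ, ∂_t^k (t^k f(t) g(t)) = Σ_{j=0}^{k} C(k,j) ∂_t^j(t^j f(t)) · ∂_t^{k−j}(t^{k−j} g(t)) − k Σ_{j=0}^{k−1} C(k−1,j) ∂_t^j(t^j f(t)) · ∂_t^{k−1−j}(t^{k−1−j} g(t)), where C(n,j) denotes the binomial coefficient. -/
open MeasureTheory Real Filter
open scoped ENNReal BigOperators Topology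

noncomputable section

abbrev Euc (d : ℕ) : Type := EuclideanSpace ℝ (Fin d)

/-- The heat kernel on `ℝ^d`. -/
noncomputable def heatKernel (d : ℕ) (t : ℝ) (x : Euc d) : ℝ :=
  (4 * Real.pi * t) ^ (-(d : ℝ) / 2) * Real.exp (-‖x‖ ^ 2 / (4 * t))

/-- Partial derivative in the `i`-th coordinate direction. -/
noncomputable def pd {d : ℕ} {F : Type*} [NormedAddCommGroup F] [NormedSpace ℝ F]
    (i : Fin d) (f : Euc d → F) : Euc d → F :=
  fun x => fderiv ℝ f x (EuclideanSpace.single i 1)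

/-- Multi-index spatial derivative `D_x^β`. -/
noncomputable def mderiv {d : ℕ} {F : Type*} [NormedAddCommGroup F] [NormedSpace ℝ F]
    (β : Fin d → ℕ) (f : Euc d → F) : Euc d → F :=
  (List.finRange d).foldr (fun i g => (pd i)^[β i] g) f

/-- `k`-th time derivative (pointwise in space). -/
noncomputable def tderiv {d : ℕ} {F : Type*} [NormedAddCommGroup F] [NormedSpace ℝ F]
    (k : ℕ) (ρ : ℝ → Euc d → F) (t : ℝ) : Euc d → F :=
  fun x => iteratedDeriv k (fun s => ρ s x) t

/-- Convolution of two scalar functions on `ℝ^d`. -/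
noncomputable def conv {d : ℕ} (f g : Euc d → ℝ) : Euc d → ℝ :=
  fun x => ∫ y, f (x - y) * g y

/-- Convolution of a vector field with a scalar function on `ℝ^d`. -/
noncomputable def convV {d : ℕ} (f : Euc d → Euc d) (g : Euc d → ℝ) : Euc d → Euc d :=
  fun x => ∫ y, g y • f (x - y)

/-- Gradient of the heat kernel. -/
noncomputable def gradHeat (d : ℕ) (t : ℝ) : Euc d → Euc d :=
  gradient (fun x => heatKernel d t x)

/-- Gradient of the logarithmic potential `c` generated by `ρ`. -/
noncomputable def gradc (d : ℕ) (ρ : Euc d → ℝ) (x : Euc d) : Euc d :=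
  (-(1 / (d * Real.pi))) • ∫ y, (ρ y / ‖x - y‖ ^ 2) • (x - y)

/-- `|β|` for a multi-index. -/
def msize {d : ℕ} (β : Fin d → ℕ) : ℕ := ∑ i, β i

/-- The exponent `2d/(2d-1)` as an element of `ℝ≥0∞`. -/
noncomputable def qd (d : ℕ) : ℝ≥0∞ := (2 * d : ℝ≥0∞) / (2 * d - 1 : ℝ≥0∞)

/-- Right-hand side of the Duhamel formula for the mPKS equations. -/
noncomputable def mildRHS (d : ℕ) (ρ₀ : Euc d → ℝ) (ρ : ℝ → Euc d → ℝ) (t : ℝ) (x : Euc d) : ℝ :=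
  conv (heatKernel d t) ρ₀ x -
    ∫ s in Set.Ioc (0:ℝ) t,
      ∫ y, (inner ℝ (gradHeat d (t - s) (x - y)) (ρ s y • gradc d (ρ s) y) : ℝ)

/-- Mild solution of the mPKS equations on `[0,T]`. -/
def IsMildSolution (d : ℕ) (ρ₀ : Euc d → ℝ) (T : ℝ) (ρ : ℝ → Euc d → ℝ) : Prop :=
  ∀ t ∈ Set.Ioc (0:ℝ) T, ∀ x, ρ t x = mildRHS d ρ₀ ρ t x

/-- Membership in the space `X_T`. -/
def MemXT (d : ℕ) (T : ℝ) (ρ : ℝ → Euc d → ℝ) : Prop :=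
  (∀ t ∈ Set.Ioc (0:ℝ) T, MemLp (ρ t) 1 volume) ∧
  (∀ t ∈ Set.Ioc (0:ℝ) T,
    Filter.Tendsto (fun s => eLpNorm (fun x => ρ s x - ρ t x) 1 volume)
      (nhdsWithin t (Set.Ioc (0:ℝ) T)) (nhds 0)) ∧
  (∃ C : ℝ≥0∞, C ≠ ⊤ ∧ ∀ t ∈ Set.Ioc (0:ℝ) T, eLpNorm (ρ t) 1 volume ≤ C) ∧
  (∃ C : ℝ≥0∞, C ≠ ⊤ ∧ ∀ t ∈ Set.Ioc (0:ℝ) T,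
    ENNReal.ofReal (t ^ (1/4 : ℝ)) * eLpNorm (ρ t) (qd d) volume ≤ C)

/-- Assumption (𝒜): decay of the heat semigroup applied to `ρ₀`. -/
def AssumptionA (d : ℕ) (ρ₀ : Euc d → ℝ) (T θ : ℝ) : Prop :=
  ∀ q : ℝ≥0∞, 1 ≤ q → ∀ t ∈ Set.Ioc (0:ℝ) T,
    ENNReal.ofReal (t ^ (((d : ℝ) / 2) * (1 - q⁻¹.toReal))) *
      eLpNorm (conv (heatKernel d t) ρ₀) q volume ≤ ENNReal.ofReal θ


lemma aux_coeff (N j : ℕ) (a : ℕ → ℝ) :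
    PowerSeries.coeff j (∑ i ∈ Finset.range N, PowerSeries.C (a i) *
      (PowerSeries.X ^ i * (PowerSeries.mk (1 : ℕ → ℝ)) ^ (i + 1))) =
    ∑ i ∈ Finset.range N, (j.choose i : ℝ) * a i := by
  rw [map_sum]
  refine Finset.sum_congr rfl fun i _ => ?_
  rw [PowerSeries.coeff_C_mul, PowerSeries.coeff_X_pow_mul',
    PowerSeries.mk_one_pow_eq_mk_choose_add, mul_comm]
  split_ifs with h
  · rw [PowerSeries.coeff_mk, Nat.add_sub_cancel' h]
  · rw [Nat.choose_eq_zero_of_lt (by omega)]; simp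

lemma aux_alg (n : ℕ) (a b : ℕ → ℝ) (p q : ℕ → ℝ)
    (hp : ∀ j ≤ n + 1, p j = ∑ i ∈ Finset.range (n + 2), (j.choose i : ℝ) * a i)
    (hq : ∀ j ≤ n + 1, q j = ∑ i ∈ Finset.range (n + 2), (j.choose i : ℝ) * b i) :
    ∑ i ∈ Finset.range (n + 2), ∑ m ∈ Finset.range (n + 2),
        ((n + 1).choose (i + m) : ℝ) * (a i * b m) =
      (∑ j ∈ Finset.range (n + 2), p j * q (n + 1 - j)) -
        ∑ j ∈ Finset.range (n + 1), p j * q (n - j) := by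
  set U : PowerSeries ℝ := PowerSeries.mk (1 : ℕ → ℝ) with hU
  set P : PowerSeries ℝ := ∑ i ∈ Finset.range (n + 2), PowerSeries.C (a i) *
      (PowerSeries.X ^ i * U ^ (i + 1)) with hP
  set Q : PowerSeries ℝ := ∑ i ∈ Finset.range (n + 2), PowerSeries.C (b i) *
      (PowerSeries.X ^ i * U ^ (i + 1)) with hQ
  have hU1 : U * (1 - PowerSeries.X) = 1 := PowerSeries.mk_one_mul_one_sub_eq_one ℝ
  have key : P * Q * (1 - PowerSeries.X) =
      ∑ i ∈ Finset.range (n + 2), ∑ m ∈ Finset.range (n + 2),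
        PowerSeries.C (a i * b m) * (PowerSeries.X ^ (i + m) * U ^ (i + m + 1)) := by
    rw [hP, hQ, Finset.sum_mul_sum, Finset.sum_mul]
    refine Finset.sum_congr rfl fun i _ => ?_
    rw [Finset.sum_mul]
    refine Finset.sum_congr rfl fun m _ => ?_
    rw [map_mul]
    linear_combination (PowerSeries.C (a i) * PowerSeries.C (b m) *
      (PowerSeries.X ^ (i + m) * U ^ (i + m + 1))) * hU1
  have h2 := congrArg (PowerSeries.coeff (n + 1)) key
  rw [mul_sub, mul_one, map_sub, PowerSeries.coeff_succ_mul_X, PowerSeries.coeff_mul,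
    PowerSeries.coeff_mul,
    Finset.Nat.sum_antidiagonal_eq_sum_range_succ
      (fun x y => PowerSeries.coeff x P * PowerSeries.coeff y Q),
    Finset.Nat.sum_antidiagonal_eq_sum_range_succ
      (fun x y => PowerSeries.coeff x P * PowerSeries.coeff y Q)] at h2
  have hP' : ∀ j ≤ n + 1, PowerSeries.coeff j P = p j := fun j hj => by
    rw [hp j hj, hP, aux_coeff]
  have hQ' : ∀ j ≤ n + 1, PowerSeries.coeff j Q = q j := fun j hj => by
    rw [hq j hj, hQ, aux_coeff]
  have e1 : ∑ j ∈ Finset.range (n + 2), p j * q (n + 1 - j) =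
      ∑ k ∈ Finset.range (n + 1).succ, PowerSeries.coeff k P * PowerSeries.coeff (n + 1 - k) Q :=
    Finset.sum_congr rfl fun j hj => by
      have := Finset.mem_range.1 hj
      rw [hP' j (by omega), hQ' _ (by omega)]
  have e2 : ∑ j ∈ Finset.range (n + 1), p j * q (n - j) =
      ∑ k ∈ Finset.range n.succ, PowerSeries.coeff k P * PowerSeries.coeff (n - k) Q :=
    Finset.sum_congr rfl fun j hj => by
      have := Finset.mem_range.1 hj
      rw [hP' j (by omega), hQ' _ (by omega)]
  rw [e1, e2, h2, map_sum]
  refine Finset.sum_congr rfl fun i _ => ?_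
  rw [map_sum]
  refine Finset.sum_congr rfl fun m _ => ?_
  rw [PowerSeries.coeff_C_mul, PowerSeries.coeff_X_pow_mul', hU,
    PowerSeries.mk_one_pow_eq_mk_choose_add, mul_comm]
  split_ifs with h
  · rw [PowerSeries.coeff_mk, Nat.add_sub_cancel' h]
  · rw [Nat.choose_eq_zero_of_lt (by omega)]; simp

lemma aux_F (f : ℝ → ℝ) (hf : ∀ n : ℕ, ContDiff ℝ n f) (t : ℝ) (N j : ℕ) (hj : j < N) :
    iteratedDeriv j (fun s => s ^ j * f s) t =
      (j.factorial : ℝ) * ∑ i ∈ Finset.range N,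
        (j.choose i : ℝ) * (t ^ i * iteratedDeriv i f t / (i.factorial : ℝ)) := by
  have h1 : (fun s => s ^ j * f s) = fun s => f s * s ^ j := by
    funext s; ring
  rw [h1, iteratedDeriv_fun_mul (hf j).contDiffAt (by fun_prop), Finset.mul_sum]
  have hsub : Finset.range (j + 1) ⊆ Finset.range N := by
    intro x hx; rw [Finset.mem_range] at *; omega
  rw [← Finset.sum_subset hsub]
  · refine Finset.sum_congr rfl fun i hi => ?_
    have hi' := Finset.mem_range.1 hi
    have hd : iteratedDeriv (j - i) (fun s : ℝ => s ^ j) t =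
        (j.descFactorial (j - i) : ℝ) * t ^ i := by
      have := iteratedDeriv_pow (x := t) j (j - i)
      rw [show j - (j - i) = i by omega] at this
      exact this
    have hfac : (i.factorial : ℝ) * (j.descFactorial (j - i) : ℝ) = j.factorial := by
      have := Nat.factorial_mul_descFactorial (show j - i ≤ j by omega)
      rw [show j - (j - i) = i by omega] at this
      exact_mod_cast this
    have h0 : (i.factorial : ℝ) ≠ 0 := by positivity
    rw [hd, ← hfac]
    field_simp
  · intro x _ hx
    rw [Finset.mem_range] at hx
    rw [Nat.choose_eq_zero_of_lt (by omega)]; simp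

lemma aux_mul (f g : ℝ → ℝ) (hf : ∀ n : ℕ, ContDiff ℝ n f) (hg : ∀ n : ℕ, ContDiff ℝ n g)
    (t : ℝ) (n : ℕ) :
    t ^ n * iteratedDeriv n (fun s => f s * g s) t / (n.factorial : ℝ) =
      ∑ x ∈ Finset.HasAntidiagonal.antidiagonal n, (t ^ x.1 * iteratedDeriv x.1 f t / (x.1.factorial : ℝ)) *
        (t ^ x.2 * iteratedDeriv x.2 g t / (x.2.factorial : ℝ)) := by
  rw [iteratedDeriv_fun_mul (hf n).contDiffAt (hg n).contDiffAt,
    ← Finset.Nat.sum_antidiagonal_eq_sum_range_succ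
      (fun i m => (n.choose i : ℝ) * iteratedDeriv i f t * iteratedDeriv m g t),
    Finset.mul_sum, Finset.sum_div]
  refine Finset.sum_congr rfl fun x hx => ?_
  obtain ⟨i, m⟩ := x
  have hx' : i + m = n := Finset.HasAntidiagonal.mem_antidiagonal.1 hx
  subst hx'
  have h : ((i + m).choose i : ℝ) * i.factorial * m.factorial = (i + m).factorial := by
    have := Nat.choose_mul_factorial_mul_factorial (show i ≤ i + m by omega)
    rw [Nat.add_sub_cancel_left] at this
    exact_mod_cast this
  have h1 : (i.factorial : ℝ) ≠ 0 := by positivity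
  have h2 : (m.factorial : ℝ) ≠ 0 := by positivity
  have h3 : ((i + m).factorial : ℝ) ≠ 0 := by positivity
  dsimp only
  rw [div_mul_div_comm, div_eq_div_iff h3 (mul_ne_zero h1 h2), ← h, pow_add]
  ring

lemma aux_sum (K : ℕ) (c : ℕ → ℕ → ℝ) :
    ∑ n ∈ Finset.range (K + 1), (K.choose n : ℝ) * ∑ x ∈ Finset.HasAntidiagonal.antidiagonal n, c x.1 x.2 =
      ∑ i ∈ Finset.range (K + 1), ∑ m ∈ Finset.range (K + 1),
        (K.choose (i + m) : ℝ) * c i m := by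
  simp_rw [Finset.mul_sum]
  rw [← Finset.sum_product', Finset.sum_sigma']
  refine Finset.sum_bij_ne_zero (fun x _ _ => x.2) ?_ ?_ ?_ ?_
  · rintro ⟨n, i, m⟩ h _
    simp at h ⊢
    omega
  · rintro ⟨n, i, m⟩ h _ ⟨n', i', m'⟩ h' _ e
    simp at h h' e
    obtain ⟨rfl, rfl⟩ := e
    obtain rfl := h.2
    obtain rfl := h'.2
    rfl
  · rintro ⟨i, m⟩ h h0
    have hle : i + m ≤ K := by
      by_contra hc
      apply h0
      simp [Nat.choose_eq_zero_of_lt (show K < i + m by omega)]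
    exact ⟨⟨i + m, i, m⟩, by simp; omega, h0, rfl⟩
  · rintro ⟨n, i, m⟩ h _
    simp at h
    obtain rfl := h.2
    rfl

/-- Dong–Zhang's Leibniz-type identity for `∂_t^k (t^k f g)`. -/
theorem iteratedDeriv_pow_mul_mul (f g : ℝ → ℝ)
    (hf : ∀ n : ℕ, ContDiff ℝ n f) (hg : ∀ n : ℕ, ContDiff ℝ n g)
    (k : ℕ) (hk : 1 ≤ k) (t : ℝ) :
    iteratedDeriv k (fun s => s ^ k * (f s * g s)) t =
      (∑ j ∈ Finset.range (k + 1),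
          (k.choose j : ℝ) * iteratedDeriv j (fun s => s ^ j * f s) t *
            iteratedDeriv (k - j) (fun s => s ^ (k - j) * g s) t) -
        (k : ℝ) *
          ∑ j ∈ Finset.range k,
            ((k - 1).choose j : ℝ) * iteratedDeriv j (fun s => s ^ j * f s) t *
              iteratedDeriv (k - 1 - j) (fun s => s ^ (k - 1 - j) * g s) t := by
  obtain ⟨n, rfl⟩ : ∃ n, k = n + 1 := ⟨k - 1, by omega⟩
  have hfg : ∀ n : ℕ, ContDiff ℝ n (fun s => f s * g s) := fun n => (hf n).mul (hg n)
  have hne : ∀ j : ℕ, (j.factorial : ℝ) ≠ 0 := fun j => by positivity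
  have hA := aux_alg n (fun i => t ^ i * iteratedDeriv i f t / (i.factorial : ℝ))
    (fun i => t ^ i * iteratedDeriv i g t / (i.factorial : ℝ))
    (fun j => iteratedDeriv j (fun s => s ^ j * f s) t / (j.factorial : ℝ))
    (fun j => iteratedDeriv j (fun s => s ^ j * g s) t / (j.factorial : ℝ))
    (fun j hj => by
      rw [aux_F f hf t (n + 2) j (by omega), mul_div_cancel_left₀ _ (hne j)])
    (fun j hj => by
      rw [aux_F g hg t (n + 2) j (by omega), mul_div_cancel_left₀ _ (hne j)])
  rw [aux_F _ hfg t (n + 2) (n + 1) (by omega)]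
  simp_rw [aux_mul f g hf hg t]
  rw [aux_sum (n + 1) (fun i m => (t ^ i * iteratedDeriv i f t / (i.factorial : ℝ)) *
        (t ^ m * iteratedDeriv m g t / (m.factorial : ℝ))), hA, mul_sub]
  have hch : ∀ j K : ℕ, j ≤ K → ∀ u v : ℝ,
      (K.factorial : ℝ) * (u / (j.factorial : ℝ) * (v / ((K - j).factorial : ℝ))) =
        (K.choose j : ℝ) * u * v := by
    intro j K h u v
    have h1 := hne j
    have h2 := hne (K - j)
    have : (K.choose j : ℝ) * j.factorial * (K - j).factorial = K.factorial := by
      exact_mod_cast Nat.choose_mul_factorial_mul_factorial h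
    rw [← this]
    field_simp
  congr 1
  · rw [Finset.mul_sum]
    refine Finset.sum_congr rfl fun j hj => ?_
    exact hch j (n + 1) (by have := Finset.mem_range.1 hj; omega) _ _
  · rw [Nat.factorial_succ, Nat.cast_mul, mul_assoc, Finset.mul_sum, Nat.add_sub_cancel]
    congr 1
    refine Finset.sum_congr rfl fun j hj => ?_
    exact hch j n (by have := Finset.mem_range.1 hj; omega) _ _

end
end

section
/- Let d ∈ ℕ, d ≥ 1, and let ρ₀ ∈ L¹(ℝ^d) with ρ₀ ≥ 0 and ‖ρ₀‖_{L¹(ℝ^d)} sufficiently small. Then the mild solution ρ of the mPKS equations with initial datum ρ₀ exists globally in time, and there exists a constant M > 0, independent of t, β and k, such that for every multi-index β ∈ ℕ^d and every k ∈ ℕ with |β| + k > 0, every 1 ≤ q ≤ ∞ and every t ∈ (0,∞), ‖D_x^β ∂_t^k ρ(t)‖_{L^q(ℝ^d)} ≤ M^{|β|+k} (|β|+k)^{|β|+k} t^{−|β|/2 − k − (d/2)(1−1/q)}. -/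
open MeasureTheory Real Filter
open scoped ENNReal BigOperators Topology

noncomputable section

section

lemma line_diff {P : Type*} [NormedAddCommGroup P] [NormedSpace ℂ P] {f : P → ℂ} {p v : P} {r R : ℝ}
    (hf : DifferentiableOn ℂ f (Metric.ball p R)) (hr : r * ‖v‖ < R) (h0 : 0 ≤ r) :
    DifferentiableOn ℂ (fun w : ℂ => f (p + w • v)) (Metric.closedBall 0 r) := by
  intro w hw
  have hmem : p + w • v ∈ Metric.ball p R := by
    simp only [Metric.mem_ball, dist_eq_norm, add_sub_cancel_left, norm_smul]
    have : ‖w‖ ≤ r := by simpa using hw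
    nlinarith [norm_nonneg v]
  have h1 : DifferentiableAt ℂ f (p + w • v) := hf.differentiableAt (Metric.isOpen_ball.mem_nhds hmem)
  exact (h1.comp w (by fun_prop : DifferentiableAt ℂ (fun w : ℂ => p + w • v) w)).differentiableWithinAt

lemma norm_fderiv_le_cauchy {P : Type*} [NormedAddCommGroup P] [NormedSpace ℂ P] {f : P → ℂ} {p : P}
    {r R C : ℝ} (hr : 0 < r) (hrR : r < R) (hf : DifferentiableOn ℂ f (Metric.ball p R))
    (hC : ∀ q ∈ Metric.ball p R, ‖f q‖ ≤ C) : ‖fderiv ℂ f p‖ ≤ C / r := by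
  have hp : p ∈ Metric.ball p R := Metric.mem_ball_self (hr.trans hrR)
  have hC0 : 0 ≤ C := (norm_nonneg _).trans (hC p hp)
  refine ContinuousLinearMap.opNorm_le_bound _ (by positivity) fun v => ?_
  by_cases hv : v = 0
  · simp [hv]
  have hv' : 0 < ‖v‖ := norm_pos_iff.2 hv
  have hd : HasDerivAt (fun w : ℂ => f (p + w • v)) (fderiv ℂ f p v) 0 := by
    have h1 : HasFDerivAt f (fderiv ℂ f p) (p + (0:ℂ) • v) := by
      simpa using (hf.differentiableAt (Metric.isOpen_ball.mem_nhds hp)).hasFDerivAt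
    have h2 : HasDerivAt (fun w : ℂ => p + w • v) v 0 := by
      simpa using ((hasDerivAt_id (0:ℂ)).smul_const v).const_add p
    exact h1.comp_hasDerivAt 0 h2
  rw [← hd.deriv]
  have := Complex.norm_deriv_le_of_forall_mem_sphere_norm_le (c := 0) (R := r / ‖v‖) (C := C)
    (f := fun w : ℂ => f (p + w • v)) (by positivity)
    (((line_diff hf (r := r / ‖v‖) (v := v) (by rw [div_mul_cancel₀ _ hv'.ne']; exact hrR)
      (by positivity)).mono Metric.closure_ball_subset_closedBall).diffContOnCl)
    (by
      intro z hz
      apply hC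
      have : ‖z‖ = r / ‖v‖ := by simpa using hz
      simp only [Metric.mem_ball, dist_eq_norm, add_sub_cancel_left, norm_smul, this]
      rw [div_mul_cancel₀ _ hv'.ne']; exact hrR)
  refine this.trans (le_of_eq ?_)
  field_simp

lemma hol_integral {P : Type*} [NormedAddCommGroup P] [NormedSpace ℂ P] [FiniteDimensional ℂ P]
    {Ω : Type*} [MeasurableSpace Ω] {ν : Measure Ω} {U : Set P} (hU : IsOpen U)
    {F : P → Ω → ℂ} {g : Ω → ℝ≥0∞} (hgm : AEMeasurable g ν) (hg : ∫⁻ ω, g ω ∂ν ≠ ⊤)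
    (hF : ∀ ω, DifferentiableOn ℂ (fun p => F p ω) U)
    (hm : ∀ p ∈ U, AEStronglyMeasurable (F p) ν)
    (hb : ∀ p ∈ U, ∀ ω, ‖F p ω‖ₑ ≤ g ω) :
    DifferentiableOn ℂ (fun p => ∫ ω, F p ω ∂ν) U := by
  intro p₀ hp₀
  obtain ⟨R, hR, hRU⟩ := Metric.isOpen_iff.1 hU p₀ hp₀
  have hfin : ∀ᵐ ω ∂ν, g ω < ⊤ := ae_lt_top' hgm hg
  have hgi : Integrable (fun ω => (g ω).toReal) ν := integrable_toReal_of_lintegral_ne_top hgm hg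
  have hbr : ∀ ω, g ω < ⊤ → ∀ p ∈ U, ‖F p ω‖ ≤ (g ω).toReal := by
    intro ω hω p hp
    have := ENNReal.toReal_mono hω.ne (hb p hp ω)
    simpa using this
  have hsub : ∀ p ∈ Metric.ball p₀ (R/2), Metric.ball p (R/2) ⊆ U := by
    intro p hp q hq
    apply hRU
    simp only [Metric.mem_ball] at *
    linarith [dist_triangle q p p₀]
  have hmeas' : AEStronglyMeasurable (fun ω => fderiv ℂ (fun p => F p ω) p₀) ν := by
    let b := Module.finBasis ℂ P
    have hcomp : ∀ v : P, AEStronglyMeasurable (fun ω => fderiv ℂ (fun p => F p ω) p₀ v) ν := by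
      intro v
      let δ : ℕ → ℂ := fun n => (1 : ℂ) / ((n : ℂ) + 1)
      have hδ : Tendsto δ atTop (𝓝 0) := tendsto_one_div_add_atTop_nhds_zero_nat
      have hδ0 : ∀ n, δ n ≠ 0 := by
        intro n; simp only [δ]
        have : (n:ℂ) + 1 ≠ 0 := by exact_mod_cast Nat.succ_ne_zero n
        exact one_div_ne_zero this
      have hev : ∀ᶠ n in atTop, p₀ + δ n • v ∈ U := by
        have : Tendsto (fun n => p₀ + δ n • v) atTop (𝓝 (p₀ + (0:ℂ) • v)) :=
          tendsto_const_nhds.add (hδ.smul_const v)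
        rw [zero_smul, add_zero] at this
        exact this (hU.mem_nhds hp₀)
      obtain ⟨N, hN⟩ := eventually_atTop.1 hev
      refine aestronglyMeasurable_of_tendsto_ae atTop
        (f := fun n ω => (δ (n+N))⁻¹ • (F (p₀ + δ (n+N) • v) ω - F p₀ ω)) ?_ ?_
      · intro n
        exact ((hm _ (hN (n+N) (by omega))).sub (hm _ hp₀)).const_smul (δ (n+N))⁻¹
      · refine ae_of_all _ fun ω => ?_
        have hd : HasDerivAt (fun w : ℂ => F (p₀ + w • v) ω) (fderiv ℂ (fun p => F p ω) p₀ v) 0 := by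
          have h1 : HasFDerivAt (fun p => F p ω) (fderiv ℂ (fun p => F p ω) p₀) (p₀ + (0:ℂ) • v) := by
            simpa using ((hF ω).differentiableAt (hU.mem_nhds hp₀)).hasFDerivAt
          have h2 : HasDerivAt (fun w : ℂ => p₀ + w • v) v 0 := by
            simpa using ((hasDerivAt_id (0:ℂ)).smul_const v).const_add p₀
          exact h1.comp_hasDerivAt 0 h2
        have hs := hasDerivAt_iff_tendsto_slope_zero.1 hd
        have ht : Tendsto (fun n => δ (n+N)) atTop (𝓝[≠] 0) := by
          rw [tendsto_nhdsWithin_iff]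
          exact ⟨(tendsto_add_atTop_iff_nat N).2 hδ, Eventually.of_forall fun n => hδ0 _⟩
        have := hs.comp ht
        simpa [Function.comp_def] using this
    have heq : (fun ω => fderiv ℂ (fun p => F p ω) p₀) =
        fun ω => ∑ i, (fderiv ℂ (fun p => F p ω) p₀ (b i)) •
          (LinearMap.toContinuousLinearMap (b.coord i)) := by
      funext ω
      ext v
      conv_lhs => rw [← b.sum_repr v, map_sum]
      simp [mul_comm]
    rw [heq]
    refine Finset.aestronglyMeasurable_fun_sum _ fun i _ => ?_
    exact (hcomp (b i)).smul_const _
  have hmain := hasFDerivAt_integral_of_dominated_of_fderiv_le (𝕜 := ℂ) (μ := ν)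
    (F := F) (F' := fun p ω => fderiv ℂ (fun p => F p ω) p) (x₀ := p₀)
    (s := Metric.ball p₀ (R/2)) (bound := fun ω => (g ω).toReal / (R/4))
    (Metric.ball_mem_nhds _ (by positivity))
    (by filter_upwards [hU.mem_nhds hp₀] with p hp using hm p hp)
    (by
      refine Integrable.mono' hgi (hm _ hp₀) ?_
      filter_upwards [hfin] with ω hω using hbr ω hω p₀ hp₀)
    hmeas'
    (by
      filter_upwards [hfin] with ω hω p hp
      exact norm_fderiv_le_cauchy (by positivity) (by linarith : R/4 < R/2)
        ((hF ω).mono (hsub p hp)) (fun q hq => hbr ω hω q (hsub p hp hq)))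
    (hgi.div_const _)
    (by
      refine ae_of_all _ fun ω p hp => ?_
      have : p ∈ U := hsub p hp (Metric.mem_ball_self (by positivity))
      exact ((hF ω).differentiableAt (hU.mem_nhds this)).hasFDerivAt)
  exact hmain.differentiableAt.differentiableWithinAt

/-- n-th directional derivative -/
def Dv {P X : Type*} [NormedAddCommGroup P] [NormedSpace ℂ P] (v : P) (n : ℕ) (f : P → X → ℂ) :
    P → X → ℂ := fun p x => iteratedDeriv n (fun w : ℂ => f (p + w • v) x) 0

/-- holomorphic with envelope -/
structure GoodE {P X : Type*} [NormedAddCommGroup P] [NormedSpace ℂ P] (f : P → X → ℂ) (R : ℝ)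
    (E : X → ℝ) : Prop where
  hol : ∀ x, DifferentiableOn ℂ (fun p => f p x) (Metric.ball 0 R)
  bd : ∀ p ∈ Metric.ball (0:P) R, ∀ x, ‖f p x‖ ≤ E x

lemma GoodE.Dv {P X : Type*} [NormedAddCommGroup P] [NormedSpace ℂ P] [FiniteDimensional ℂ P]
    {f : P → X → ℂ} {R : ℝ} {E : X → ℝ} (h : GoodE f R E) {v : P} (hv : ‖v‖ ≤ 1) (n : ℕ) {r : ℝ}
    (hr : 0 < r) (hrR : 2 * r ≤ R) :
    GoodE (Dv v n f) (R - 2 * r) (fun x => n.factorial / r ^ n * E x) := by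
  have hsub : ∀ p ∈ Metric.ball (0:P) (R - 2 * r), Metric.ball p (2*r) ⊆ Metric.ball 0 R := by
    intro p hp q hq
    simp only [Metric.mem_ball] at *
    linarith [dist_triangle q p 0]
  have hin : ∀ p ∈ Metric.ball (0:P) (R - 2 * r), ∀ w : ℂ, ‖w‖ ≤ r → p + w • v ∈ Metric.ball (0:P) R := by
    intro p hp w hw
    apply hsub p hp
    simp only [Metric.mem_ball, dist_eq_norm, add_sub_cancel_left, norm_smul]
    nlinarith [norm_nonneg v, norm_nonneg w]
  have hline : ∀ p ∈ Metric.ball (0:P) (R - 2 * r), ∀ x,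
      DifferentiableOn ℂ (fun w : ℂ => f (p + w • v) x) (Metric.closedBall 0 r) := by
    intro p hp x
    exact line_diff ((h.hol x).mono (hsub p hp)) (by nlinarith [norm_nonneg v]) hr.le
  constructor
  · intro x
    have heq : ∀ p ∈ Metric.ball (0:P) (R - 2 * r), _root_.Dv v n f p x =
        (2 * π * Complex.I / n.factorial)⁻¹ *
          ∮ z in C(0, r), (1 / (z - 0) ^ (n + 1)) • f (p + z • v) x := by
      intro p hp
      rw [(hline p hp x).circleIntegral_one_div_sub_center_pow_smul hr n]
      have : (2 * π * Complex.I / n.factorial : ℂ) ≠ 0 := by simp [Nat.factorial_ne_zero]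
      simp only [_root_.Dv, smul_eq_mul]
      rw [inv_mul_cancel_left₀ this]
    refine DifferentiableOn.congr ?_ heq
    refine DifferentiableOn.const_mul ?_ _
    unfold circleIntegral
    simp_rw [intervalIntegral.integral_of_le two_pi_pos.le]
    refine hol_integral Metric.isOpen_ball
      (g := fun _ => ENNReal.ofReal (r * (1 / r ^ (n+1)) * E x)) (by fun_prop) (by simp [ENNReal.mul_eq_top]) ?_ ?_ ?_
    · intro θ
      simp only [smul_eq_mul]
      refine DifferentiableOn.const_mul (DifferentiableOn.const_mul ?_ _) _
      intro p hp
      have hmem := hin p hp (circleMap 0 r θ) (by simp [abs_of_pos hr])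
      have h1 := (h.hol x).differentiableAt (Metric.isOpen_ball.mem_nhds hmem)
      exact (h1.comp p (f := fun p => p + circleMap 0 r θ • v) (by fun_prop)).differentiableWithinAt
    · intro p hp
      have hc : Continuous (fun θ => f (p + circleMap 0 r θ • v) x) := by
        refine ContinuousOn.comp_continuous (hline p hp x).continuousOn (continuous_circleMap 0 r) ?_
        intro θ; simp [abs_of_pos hr]
      have : Measurable (fun θ => deriv (circleMap 0 r) θ • (1 / (circleMap 0 r θ - 0) ^ (n + 1)) • f (p + circleMap 0 r θ • v) x) := by
        simp only [deriv_circleMap, smul_eq_mul]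
        have h1 := hc.measurable
        have h2 := (continuous_circleMap 0 r).measurable
        refine (h2.mul_const _).mul (Measurable.mul ?_ h1)
        exact ((h2.sub_const 0).pow_const (n+1)).const_div 1
      exact this.aestronglyMeasurable
    · intro p hp θ
      rw [← ofReal_norm]
      apply ENNReal.ofReal_le_ofReal
      have hb := h.bd _ (hin p hp (circleMap 0 r θ) (by simp [abs_of_pos hr])) x
      simp only [deriv_circleMap, norm_smul, norm_mul, Complex.norm_I, sub_zero, norm_div, norm_one,
        norm_pow, norm_circleMap_zero, abs_of_pos hr, mul_one]
      rw [mul_assoc]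
      gcongr
  · intro p hp x
    have := Complex.norm_iteratedDeriv_le_of_forall_mem_sphere_norm_le (c := 0) (R := r) (C := E x)
      (f := fun w : ℂ => f (p + w • v) x) n hr
      (((hline p hp x).mono Metric.closure_ball_subset_closedBall).diffContOnCl)
      (by
        intro z hz
        apply h.bd
        exact hin p hp z (by simpa using (Metric.sphere_subset_closedBall hz)))
    refine this.trans (le_of_eq ?_)
    ring

end

section

abbrev PP (d : ℕ) : Type := (Fin d → ℂ) × ℂ

/-- complexified, sheared heat kernel -/
def Gc {d : ℕ} (p : PP d) (s : ℝ) (X : Euc d) : ℂ :=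
  (((4 * π * s) ^ (-(d:ℝ)/2) : ℝ) : ℂ) * p.2 ^ (((-(d:ℝ)/2 : ℝ)) : ℂ) *
    Complex.exp (-(∑ i, ((X i : ℂ) + s * p.1 i) ^ 2) / (4 * s * p.2))

def Kk {d : ℕ} (i : Fin d) (x : Euc d) : ℝ :=
  if 2 ≤ d then -(1 / (d * π)) * (x i / ‖x‖ ^ 2) else 0

def Ker {d : ℕ} (p : PP d) (s : ℝ) (x : Euc d) (ω : ℝ × Euc d × Euc d) : ℂ :=
  if 0 < ω.1 ∧ ω.1 < s then
    ∑ i, (-((x i - ω.2.1 i : ℝ) + ((s - ω.1 : ℝ) : ℂ) * p.1 i) / (2 * ((s - ω.1 : ℝ) : ℂ))) *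
      Gc p (s - ω.1) (x - ω.2.1) * (Kk i (ω.2.1 - ω.2.2) : ℂ)
  else 0

def Gam {d : ℕ} (s : ℝ) (X : Euc d) : ℝ := s ^ (-(d:ℝ)/2) * exp (-‖X‖ ^ 2 / (16 * s))

def Kn {d : ℕ} (x : Euc d) : ℝ := if 2 ≤ d then ‖x‖⁻¹ else 0

def kmaj {d : ℕ} (C : ℝ) (s : ℝ) (x : Euc d) (ω : ℝ × Euc d × Euc d) : ℝ≥0∞ :=
  if 0 < ω.1 ∧ ω.1 < s then
    ENNReal.ofReal (C * (s - ω.1) ^ (-(1:ℝ)/2)) * ENNReal.ofReal (Gam (s - ω.1) (x - ω.2.1)) *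
      ENNReal.ofReal (Kn (ω.2.1 - ω.2.2))
  else 0

/-- admissible parameters at time `t` -/
def Adm (d : ℕ) (t : ℝ) : Set (PP d) := {p | ‖p.1‖ * √t < 1/8 ∧ ‖p.2 - 1‖ < 1/8}

lemma isOpen_Adm (d : ℕ) (t : ℝ) : IsOpen (Adm d t) := by
  have h1 : IsOpen {p : PP d | ‖p.1‖ * √t < 1/8} := isOpen_lt (by fun_prop) (by fun_prop)
  have h2 : IsOpen {p : PP d | ‖p.2 - 1‖ < 1/8} := isOpen_lt (by fun_prop) (by fun_prop)
  exact h1.inter h2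

lemma Adm_mono {d : ℕ} {s t : ℝ} (h : s ≤ t) : Adm d t ⊆ Adm d s := by
  intro p hp
  refine ⟨lt_of_le_of_lt ?_ hp.1, hp.2⟩
  gcongr

lemma mu_bounds {μ : ℂ} (h : ‖μ - 1‖ < 1/8) : 7/8 ≤ ‖μ‖ ∧ ‖μ⁻¹ - 1‖ ≤ 1/7 ∧ ‖μ⁻¹‖ ≤ 8/7 ∧ μ ≠ 0 := by
  have h1 : 7/8 ≤ ‖μ‖ := by
    have := norm_sub_norm_le (1:ℂ) (1 - μ)
    rw [norm_sub_rev] at h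
    simp at this; linarith
  have h0 : μ ≠ 0 := by intro h0; rw [h0] at h1; simp at h1; linarith
  refine ⟨h1, ?_, ?_, h0⟩
  · have : μ⁻¹ - 1 = -(μ - 1) * μ⁻¹ := by field_simp; ring
    rw [this, norm_mul, norm_neg, norm_inv, ← div_eq_mul_inv, div_le_iff₀ (by linarith)]
    linarith
  · rw [norm_inv, inv_le_comm₀ (by linarith) (by norm_num)]; norm_num; linarith

lemma re_bound {X s : ℝ} {κ μ : ℂ} (hs : 0 < s) (hκ : ‖κ‖ * √s < 1/8) (hμ : ‖μ - 1‖ < 1/8) :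
    X ^ 2 / (8 * s) - 1 ≤ (((X:ℂ) + s * κ) ^ 2 / (4 * s * μ)).re := by
  obtain ⟨h1, h2, h3, h0⟩ := mu_bounds hμ
  have hk : s * ‖κ‖ ^ 2 ≤ 1/64 := by
    have h5 : (‖κ‖ * √s) ^ 2 ≤ (1/8)^2 := by
      apply pow_le_pow_left₀ (by positivity) hκ.le
    rw [mul_pow, Real.sq_sqrt hs.le] at h5
    linarith
  have e1 : ((X:ℂ) + s * κ) ^ 2 / (4 * s * μ) = (((1 / (4 * s) : ℝ)) : ℂ) *
      ((X ^ 2 : ℝ) + ((X^2 : ℝ) * (μ⁻¹ - 1) + ((2 * X * s : ℝ) * κ * μ⁻¹ + (s ^ 2 : ℝ) * κ ^ 2 * μ⁻¹))) := by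
    have hs' : (s:ℂ) ≠ 0 := by exact_mod_cast hs.ne'
    push_cast
    field_simp
    ring
  rw [e1, Complex.re_ofReal_mul, Complex.add_re, Complex.ofReal_re]
  have hn : ‖((X^2 : ℝ) * (μ⁻¹ - 1) + ((2 * X * s : ℝ) * κ * μ⁻¹ + (s ^ 2 : ℝ) * κ ^ 2 * μ⁻¹) : ℂ)‖ ≤
      X ^ 2 * (1/7) + (2 * |X| * s * ‖κ‖ * (8/7) + s ^ 2 * ‖κ‖ ^ 2 * (8/7)) := by
    refine (norm_add_le _ _).trans (add_le_add ?_ ((norm_add_le _ _).trans (add_le_add ?_ ?_)))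
    · rw [norm_mul, Complex.norm_real, Real.norm_of_nonneg (by positivity)]; gcongr
    · rw [norm_mul, norm_mul, Complex.norm_real]
      have : ‖2 * X * s‖ = 2 * |X| * s := by simp [abs_mul, abs_of_pos hs]
      rw [this]; gcongr
    · rw [norm_mul, norm_mul, norm_pow, Complex.norm_real, Real.norm_of_nonneg (by positivity)]; gcongr
  have hre := (abs_le.1 (Complex.abs_re_le_norm ((X^2 : ℝ) * (μ⁻¹ - 1) + ((2 * X * s : ℝ) * κ * μ⁻¹ + (s ^ 2 : ℝ) * κ ^ 2 * μ⁻¹) : ℂ))).1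
  have hre2 := hre
  generalize (((X^2 : ℝ) * (μ⁻¹ - 1) + ((2 * X * s : ℝ) * κ * μ⁻¹ + (s ^ 2 : ℝ) * κ ^ 2 * μ⁻¹) : ℂ)) = Z at *
  have hsq : X ^ 2 = |X| ^ 2 := (sq_abs X).symm
  have h6 : X ^ 2 / 2 - 4 * s ≤ X ^ 2 + Z.re := by
    have : s ^ 2 * ‖κ‖ ^ 2 ≤ s * (1/64) := by nlinarith
    nlinarith [sq_nonneg (|X| - 4 * (s * ‖κ‖)), sq_nonneg |X|, hsq]
  have h7 : X ^ 2 / (8 * s) - 1 = (1 / (4 * s)) * (X ^ 2 / 2 - 4 * s) := by field_simp; ring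
  rw [h7]; gcongr

lemma norm_sq_eq_sum {d : ℕ} (X : Euc d) : ‖X‖ ^ 2 = ∑ i, X i ^ 2 := by
  rw [EuclideanSpace.norm_sq_eq]; simp

lemma abs_coord_le {d : ℕ} (X : Euc d) (i : Fin d) : |X i| ≤ ‖X‖ := by
  simpa using PiLp.norm_apply_le X i

lemma exists_kernel_const (d : ℕ) : ∃ C : ℝ, 0 < C ∧ ∀ (p : PP d) (s : ℝ) (X : Euc d), 0 < s →
    p ∈ Adm d s → ‖Gc p s X‖ ≤ C * Gam s X ∧
      ∀ i, ‖(-((X i : ℂ) + (s:ℂ) * p.1 i) / (2 * (s:ℂ))) * Gc p s X‖ ≤ C * s ^ (-(1:ℝ)/2) * Gam s X := by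
  set C₀ : ℝ := (4 * π) ^ (-(d:ℝ)/2) * (7/8) ^ (-(d:ℝ)/2) * exp d with hC₀
  have hC₀pos : 0 < C₀ := by positivity
  refine ⟨3 * C₀, by positivity, ?_⟩
  intro p s X hs hp
  obtain ⟨h1, h2, h3, h0⟩ := mu_bounds hp.2
  have hpi : ∀ i, ‖p.1 i‖ * √s < 1/8 := fun i =>
    lt_of_le_of_lt (by gcongr; exact norm_le_pi_norm p.1 i) hp.1
  have hmu : ‖p.2 ^ (((-(d:ℝ)/2 : ℝ)) : ℂ)‖ ≤ (7/8) ^ (-(d:ℝ)/2) := by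
    rw [Complex.norm_cpow_of_ne_zero h0]
    simp only [Complex.ofReal_re, Complex.ofReal_im, mul_zero, Real.exp_zero, div_one]
    apply Real.rpow_le_rpow_of_nonpos (by norm_num) h1
    have : (0:ℝ) ≤ d := by positivity
    linarith
  have hexp : ‖Complex.exp (-(∑ i, ((X i : ℂ) + s * p.1 i) ^ 2) / (4 * s * p.2))‖ ≤
      exp (-‖X‖ ^ 2 / (8 * s)) * exp d := by
    rw [Complex.norm_exp, ← Real.exp_add]
    apply Real.exp_le_exp.2
    rw [neg_div, Finset.sum_div, Complex.neg_re, Complex.re_sum, norm_sq_eq_sum, neg_div, Finset.sum_div]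
    have : ∑ i, (X i ^ 2 / (8 * s) - 1) ≤ ∑ i, (((X i : ℂ) + s * p.1 i) ^ 2 / (4 * s * p.2)).re :=
      Finset.sum_le_sum fun i _ => re_bound hs (hpi i) hp.2
    rw [Finset.sum_sub_distrib] at this
    simp at this
    linarith
  have hG : ‖Gc p s X‖ ≤ C₀ * (s ^ (-(d:ℝ)/2) * exp (-‖X‖ ^ 2 / (8 * s))) := by
    unfold Gc
    rw [norm_mul, norm_mul, Complex.norm_real, Real.norm_of_nonneg (by positivity),
      Real.mul_rpow (by positivity) hs.le]
    calc _ ≤ (4 * π) ^ (-(d:ℝ)/2) * s ^ (-(d:ℝ)/2) * (7/8) ^ (-(d:ℝ)/2) * (exp (-‖X‖ ^ 2 / (8 * s)) * exp d) := by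
          gcongr
      _ = _ := by rw [hC₀]; ring
  have hsplit : exp (-‖X‖ ^ 2 / (8 * s)) = exp (-‖X‖ ^ 2 / (16 * s)) * exp (-‖X‖ ^ 2 / (16 * s)) := by
    rw [← Real.exp_add]; congr 1; field_simp; ring
  have hle1 : exp (-‖X‖ ^ 2 / (16 * s)) ≤ 1 := by
    apply Real.exp_le_one_iff.2
    apply div_nonpos_of_nonpos_of_nonneg <;> [(have := sq_nonneg ‖X‖; linarith); positivity]
  constructor
  · refine hG.trans ?_
    unfold Gam
    rw [hsplit]
    have : 0 < exp (-‖X‖ ^ 2 / (16 * s)) := Real.exp_pos _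
    have h5 : 0 < s ^ (-(d:ℝ)/2) := by positivity
    nlinarith [mul_pos hC₀pos (mul_pos h5 this), mul_le_mul_of_nonneg_left hle1 (mul_pos hC₀pos (mul_pos h5 this)).le]
  · intro i
    rw [norm_mul]
    set q := √s with hq
    have hq0 : 0 < q := Real.sqrt_pos.2 hs
    have hsq : s = q ^ 2 := (Real.sq_sqrt hs.le).symm
    have hsr : s ^ (-(1:ℝ)/2) = q⁻¹ := by
      rw [hq, Real.sqrt_eq_rpow, ← Real.rpow_neg hs.le]; congr 1; norm_num
    have hA : ‖(-((X i : ℂ) + (s:ℂ) * p.1 i) / (2 * (s:ℂ)))‖ ≤ ‖X‖ / (2 * s) + q⁻¹ := by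
      rw [norm_div, norm_neg]
      have : ‖(2 * (s:ℂ))‖ = 2 * s := by
        rw [norm_mul, Complex.norm_real, Real.norm_of_nonneg hs.le]; simp
      rw [this]
      have h8 : ‖(X i : ℂ) + (s:ℂ) * p.1 i‖ ≤ ‖X‖ + q := by
        refine (norm_add_le _ _).trans (add_le_add ?_ ?_)
        · rw [Complex.norm_real]; exact abs_coord_le X i
        · rw [norm_mul, Complex.norm_real, Real.norm_of_nonneg hs.le, hsq]
          nlinarith [hpi i, norm_nonneg (p.1 i)]
      calc _ ≤ (‖X‖ + q) / (2 * s) := by gcongr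
        _ ≤ _ := by
          rw [add_div]; gcongr
          rw [hsq, div_le_iff₀ (by positivity)]
          have : q⁻¹ * (2 * q ^ 2) = 2 * q := by field_simp
          rw [this]; linarith
    have hB : (‖X‖ / (2 * s) + q⁻¹) * exp (-‖X‖ ^ 2 / (16 * s)) ≤ 3 * q⁻¹ := by
      set a := ‖X‖ / q with ha
      have e1 : ‖X‖ / (2 * s) = (a / 2) * q⁻¹ := by rw [ha, hsq]; field_simp
      have e2 : -‖X‖ ^ 2 / (16 * s) = -(a ^ 2 / 16) := by rw [ha, hsq]; field_simp
      have h9 : (a/2) * exp (-(a ^ 2 / 16)) ≤ 2 := by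
        rw [Real.exp_neg, ← div_eq_mul_inv, div_le_iff₀ (Real.exp_pos _)]
        nlinarith [Real.add_one_le_exp (a ^ 2 / 16), sq_nonneg (a - 2)]
      have h10 : exp (-(a ^ 2 / 16)) ≤ 1 := by rw [← e2]; exact hle1
      rw [e1, e2]
      have : 0 < q⁻¹ := by positivity
      nlinarith
    calc _ ≤ (‖X‖ / (2 * s) + q⁻¹) * (C₀ * (s ^ (-(d:ℝ)/2) * exp (-‖X‖ ^ 2 / (8 * s)))) := by gcongr
      _ = C₀ * s ^ (-(d:ℝ)/2) * exp (-‖X‖ ^ 2 / (16 * s)) * ((‖X‖ / (2 * s) + q⁻¹) * exp (-‖X‖ ^ 2 / (16 * s))) := by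
          rw [hsplit]; ring
      _ ≤ C₀ * s ^ (-(d:ℝ)/2) * exp (-‖X‖ ^ 2 / (16 * s)) * (3 * q⁻¹) := by gcongr
      _ = _ := by rw [hsr]; unfold Gam; ring

lemma Kk_le {d : ℕ} (i : Fin d) (x : Euc d) : |Kk i x| ≤ Kn x := by
  unfold Kk Kn
  split_ifs with h
  · have hdp : 1 ≤ d * π := by
      have : (2:ℝ) ≤ d := by exact_mod_cast h
      nlinarith [Real.pi_gt_three]
    rw [abs_mul, abs_neg, abs_of_pos (by positivity), abs_div, abs_of_nonneg (by positivity : 0 ≤ ‖x‖^2)]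
    have h1 : 1 / (d * π) ≤ 1 := by rw [div_le_one (by positivity)]; exact hdp
    have h2 : |x i| / ‖x‖ ^ 2 ≤ ‖x‖⁻¹ := by
      by_cases hx : ‖x‖ = 0
      · simp [hx]
      have : 0 < ‖x‖ := lt_of_le_of_ne (norm_nonneg _) (Ne.symm hx)
      rw [div_le_iff₀ (by positivity)]
      have e : ‖x‖⁻¹ * ‖x‖ ^ 2 = ‖x‖ := by field_simp
      rw [e]; exact abs_coord_le x i
    have h3 : 0 ≤ |x i| / ‖x‖ ^ 2 := by positivity
    nlinarith
  · simp

lemma exists_Ker_const (d : ℕ) : ∃ C : ℝ, 0 < C ∧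
    (∀ (p : PP d) (s : ℝ) (X : Euc d), 0 < s → p ∈ Adm d s → ‖Gc p s X‖ₑ ≤ ENNReal.ofReal (C * Gam s X)) ∧
    ∀ (p : PP d) (s : ℝ) (x : Euc d) ω, p ∈ Adm d s → ‖Ker p s x ω‖ₑ ≤ kmaj C s x ω := by
  obtain ⟨C, hC, h⟩ := exists_kernel_const d
  refine ⟨(d + 1) * C, by positivity, ?_, ?_⟩
  · intro p s X hs hp
    rw [← ofReal_norm]
    apply ENNReal.ofReal_le_ofReal
    refine ((h p s X hs hp).1).trans ?_
    have : 0 ≤ Gam s X := by unfold Gam; positivity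
    have hd0 : (0:ℝ) ≤ d := by positivity
    nlinarith [mul_nonneg hd0 (mul_nonneg hC.le this)]
  · intro p s x ω hp
    unfold Ker kmaj
    split_ifs with hω
    · have hs : 0 < s - ω.1 := by linarith [hω.2]
      have hp' : p ∈ Adm d (s - ω.1) := Adm_mono (by linarith [hω.1]) hp
      have hb := (h p (s - ω.1) (x - ω.2.1) hs hp').2
      have hG0 : 0 ≤ Gam (s - ω.1) (x - ω.2.1) := by unfold Gam; positivity
      have hK0 : 0 ≤ Kn (ω.2.1 - ω.2.2) := by unfold Kn; positivity
      rw [← ENNReal.ofReal_mul (by positivity), ← ENNReal.ofReal_mul (by positivity), ← ofReal_norm]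
      apply ENNReal.ofReal_le_ofReal
      calc _ ≤ ∑ i : Fin d, (C * (s - ω.1) ^ (-(1:ℝ)/2) * Gam (s - ω.1) (x - ω.2.1)) * Kn (ω.2.1 - ω.2.2) := by
            refine norm_sum_le_of_le _ fun i _ => ?_
            rw [norm_mul, Complex.norm_real]
            refine mul_le_mul ?_ (Kk_le i _) (abs_nonneg _) (by positivity)
            have := hb i
            simpa using this
        _ = d * (C * (s - ω.1) ^ (-(1:ℝ)/2) * Gam (s - ω.1) (x - ω.2.1) * Kn (ω.2.1 - ω.2.2)) := by simp
        _ ≤ (d + 1) * (C * (s - ω.1) ^ (-(1:ℝ)/2) * Gam (s - ω.1) (x - ω.2.1) * Kn (ω.2.1 - ω.2.2)) := by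
            gcongr; linarith
        _ = _ := by ring
    · simp

end

section

lemma measurable_Gam {d : ℕ} : Measurable (fun q : ℝ × Euc d => Gam q.1 q.2) := by
  unfold Gam; fun_prop

lemma measurable_Kn {d : ℕ} : Measurable (fun x : Euc d => Kn x) := by
  unfold Kn
  split_ifs <;> fun_prop

lemma measurable_Kk {d : ℕ} (i : Fin d) : Measurable (fun x : Euc d => Kk i x) := by
  unfold Kk
  split_ifs <;> fun_prop

lemma measurable_kmaj {d : ℕ} (C : ℝ) :
    Measurable (fun q : (ℝ × Euc d) × (ℝ × Euc d × Euc d) => kmaj C q.1.1 q.1.2 q.2) := by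
  unfold kmaj
  refine Measurable.ite ?_ ?_ measurable_const
  · have h1 : MeasurableSet {q : (ℝ × Euc d) × (ℝ × Euc d × Euc d) | 0 < q.2.1} :=
      measurableSet_lt (by fun_prop) (by fun_prop)
    have h2 : MeasurableSet {q : (ℝ × Euc d) × (ℝ × Euc d × Euc d) | q.2.1 < q.1.1} :=
      measurableSet_lt (by fun_prop) (by fun_prop)
    exact h1.inter h2
  · have h1 : Measurable (fun q : (ℝ × Euc d) × (ℝ × Euc d × Euc d) => Gam (q.1.1 - q.2.1) (q.1.2 - q.2.2.1)) :=
      measurable_Gam.comp (f := fun q : (ℝ × Euc d) × (ℝ × Euc d × Euc d) => (q.1.1 - q.2.1, q.1.2 - q.2.2.1)) (by fun_prop)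
    have h2 : Measurable (fun q : (ℝ × Euc d) × (ℝ × Euc d × Euc d) => Kn (q.2.2.1 - q.2.2.2)) :=
      measurable_Kn.comp (by fun_prop)
    fun_prop

lemma measurable_Gc {d : ℕ} (p : PP d) : Measurable (fun q : ℝ × Euc d => Gc p q.1 q.2) := by
  unfold Gc; fun_prop

lemma measurable_Ker {d : ℕ} (p : PP d) :
    Measurable (fun q : (ℝ × Euc d) × (ℝ × Euc d × Euc d) => Ker p q.1.1 q.1.2 q.2) := by
  unfold Ker
  refine Measurable.ite ?_ ?_ measurable_const
  · have h1 : MeasurableSet {q : (ℝ × Euc d) × (ℝ × Euc d × Euc d) | 0 < q.2.1} :=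
      measurableSet_lt (by fun_prop) (by fun_prop)
    have h2 : MeasurableSet {q : (ℝ × Euc d) × (ℝ × Euc d × Euc d) | q.2.1 < q.1.1} :=
      measurableSet_lt (by fun_prop) (by fun_prop)
    exact h1.inter h2
  · refine Finset.measurable_fun_sum _ fun i _ => ?_
    have h1 : Measurable (fun q : (ℝ × Euc d) × (ℝ × Euc d × Euc d) => Gc p (q.1.1 - q.2.1) (q.1.2 - q.2.2.1)) :=
      (measurable_Gc p).comp (f := fun q : (ℝ × Euc d) × (ℝ × Euc d × Euc d) => (q.1.1 - q.2.1, q.1.2 - q.2.2.1)) (by fun_prop)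
    have h2 : Measurable (fun q : (ℝ × Euc d) × (ℝ × Euc d × Euc d) => Kk i (q.2.2.1 - q.2.2.2)) :=
      (measurable_Kk i).comp (by fun_prop)
    fun_prop

def TT {d : ℕ} (C : ℝ) (e e' : ℝ → Euc d → ℝ≥0∞) (s : ℝ) (x : Euc d) : ℝ≥0∞ :=
  ∫⁻ ω : ℝ × Euc d × Euc d, kmaj C s x ω * e ω.1 ω.2.1 * e' ω.1 ω.2.2

def Nrm {d : ℕ} (e : ℝ → Euc d → ℝ≥0∞) (A : ℝ≥0∞) : Prop :=
  ∀ s, 0 < s → (∫⁻ x, e s x ≤ A) ∧ ∀ x, e s x ≤ A * ENNReal.ofReal (s ^ (-(d:ℝ)/2))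

def MM {d : ℕ} (e : ℝ → Euc d → ℝ≥0∞) : Prop := Measurable (fun q : ℝ × Euc d => e q.1 q.2)

lemma MM.TT {d : ℕ} {C : ℝ} {e e' : ℝ → Euc d → ℝ≥0∞} (he : MM e) (he' : MM e') : MM (TT C e e') := by
  unfold MM _root_.TT
  have h1 : Measurable (fun q : (ℝ × Euc d) × (ℝ × Euc d × Euc d) => e q.2.1 q.2.2.1) :=
    he.comp (f := fun q : (ℝ × Euc d) × (ℝ × Euc d × Euc d) => (q.2.1, q.2.2.1)) (by fun_prop)
  have h2 : Measurable (fun q : (ℝ × Euc d) × (ℝ × Euc d × Euc d) => e' q.2.1 q.2.2.2) :=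
    he'.comp (f := fun q : (ℝ × Euc d) × (ℝ × Euc d × Euc d) => (q.2.1, q.2.2.2)) (by fun_prop)
  exact (((measurable_kmaj C).mul h1).mul h2).lintegral_prod_right'

lemma lintegral_scale {d : ℕ} {ρ : ℝ} (hρ : 0 < ρ) {f : Euc d → ℝ≥0∞} (hf : Measurable f) :
    ∫⁻ x, f x = ENNReal.ofReal (ρ ^ d) * ∫⁻ x, f (ρ • x) := by
  have h := Measure.map_addHaar_smul (volume : Measure (Euc d)) hρ.ne'
  have h2 : ∫⁻ x, f (ρ • x) = ∫⁻ x, f x ∂(Measure.map (fun x : Euc d => ρ • x) volume) := by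
    rw [lintegral_map hf (by fun_prop)]
  have h3 : (Measure.map (fun x : Euc d => ρ • x) volume) = _ := h
  rw [h2, h3, lintegral_smul_measure, smul_eq_mul, ← mul_assoc, ← ENNReal.ofReal_mul (by positivity)]
  simp only [finrank_euclideanSpace, Fintype.card_fin]
  rw [abs_of_pos (by positivity), mul_inv_cancel₀ (by positivity)]
  simp

lemma lintegral_Gam (d : ℕ) : ∃ C₂ : ℝ≥0∞, C₂ ≠ ⊤ ∧ ∀ s : ℝ, 0 < s →
    ∫⁻ X : Euc d, ENNReal.ofReal (Gam s X) = C₂ := by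
  refine ⟨ENNReal.ofReal ((16 * π) ^ ((d:ℝ)/2)), by simp, fun s hs => ?_⟩
  have h := GaussianFourier.integral_rexp_neg_mul_sq_norm (V := Euc d) (b := 1 / (16 * s)) (by positivity)
  have hi : Integrable (fun v : Euc d => rexp (-(1 / (16 * s)) * ‖v‖ ^ 2)) := by
    by_contra hcon
    rw [integral_undef hcon] at h
    have : 0 < (π / (1 / (16 * s))) ^ ((Module.finrank ℝ (Euc d) : ℝ) / 2) := by positivity
    linarith
  have e1 : (fun X : Euc d => Gam s X) = fun X => s ^ (-(d:ℝ)/2) * rexp (-(1 / (16 * s)) * ‖X‖ ^ 2) := by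
    funext X; unfold Gam; congr 2; ring
  rw [← ofReal_integral_eq_lintegral_ofReal]
  · rw [e1, integral_const_mul, h]
    congr 1
    simp only [finrank_euclideanSpace, Fintype.card_fin]
    have : π / (1 / (16 * s)) = (16 * π) * s := by field_simp
    rw [this, Real.mul_rpow (by positivity) hs.le, mul_left_comm, ← Real.rpow_add hs]
    ring_nf; simp
  · show Integrable (fun X => Gam s X)
    rw [e1]; exact hi.const_mul _
  · refine ae_of_all _ fun X => ?_
    simp only [Pi.zero_apply]; unfold Gam; positivity

lemma exists_K_const (d : ℕ) : ∃ C₃ : ℝ≥0∞, C₃ ≠ ⊤ ∧ ∀ (h : Euc d → ℝ≥0∞) (r : ℝ) (A : ℝ≥0∞),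
    Measurable h → 0 < r → ∫⁻ x, h x ≤ A → (∀ x, h x ≤ A * ENNReal.ofReal (r ^ (-(d:ℝ)/2))) →
    ∀ y, ∫⁻ z, ENNReal.ofReal (Kn (y - z)) * h z ≤ C₃ * A * ENNReal.ofReal (r ^ (-(1:ℝ)/2)) := by
  by_cases hd : 2 ≤ d
  swap
  · refine ⟨0, by simp, ?_⟩
    intro h r A _ _ _ _ y
    simp [Kn, hd]
  set φ : Euc d → ℝ≥0∞ := (Metric.ball 0 1).indicator (fun w => ENNReal.ofReal ‖w‖⁻¹) with hφ
  set J := ∫⁻ w, φ w with hJ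
  have hJfin : J ≠ ⊤ := by
    have hi : IntegrableOn (fun w : Euc d => ‖w‖⁻¹) (Metric.ball 0 1) := by
      refine integrableOn_ball_of_norm_le_rpow (C := 1) (α := 1) (by simp; omega) ?_ ?_ ?_
      · simp only [finrank_euclideanSpace, Fintype.card_fin]; exact_mod_cast hd
      · refine ae_of_all _ fun x => ?_
        simp [Real.rpow_neg_one]
      · exact (by fun_prop : Measurable (fun w : Euc d => ‖w‖⁻¹)).aestronglyMeasurable
    rw [hJ, hφ, lintegral_indicator measurableSet_ball]
    have := hi.lintegral_lt_top
    exact this.ne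
  refine ⟨1 + J, by simp [hJfin], ?_⟩
  intro h r A hm hr h1 h2 y
  set q := √r with hq
  have hq0 : 0 < q := Real.sqrt_pos.2 hr
  have hsr : r ^ (-(1:ℝ)/2) = q⁻¹ := by
    rw [hq, Real.sqrt_eq_rpow, ← Real.rpow_neg hr.le]; congr 1; norm_num
  rw [hsr]
  have hφm : Measurable φ := Measurable.indicator (by fun_prop) measurableSet_ball
  have hpt : ∀ w : Euc d, ENNReal.ofReal (Kn w) ≤
      ENNReal.ofReal q⁻¹ + ENNReal.ofReal q⁻¹ * φ (q⁻¹ • w) := by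
    intro w
    simp only [Kn, hd, if_true]
    by_cases hw : ‖w‖ < q
    · refine le_trans ?_ le_add_self
      have hmem : q⁻¹ • w ∈ Metric.ball (0:Euc d) 1 := by
        rw [mem_ball_zero_iff, norm_smul, Real.norm_of_nonneg (by positivity)]
        rw [inv_mul_lt_iff₀ hq0]; simpa using hw
      rw [hφ, Set.indicator_of_mem hmem, ← ENNReal.ofReal_mul (by positivity)]
      apply ENNReal.ofReal_le_ofReal
      rw [norm_smul, Real.norm_of_nonneg (by positivity)]
      apply le_of_eq
      field_simp
    · refine le_trans ?_ le_self_add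
      apply ENNReal.ofReal_le_ofReal
      push Not at hw
      gcongr
  calc ∫⁻ z, ENNReal.ofReal (Kn (y - z)) * h z
      ≤ ∫⁻ z, (ENNReal.ofReal q⁻¹ * h z + ENNReal.ofReal q⁻¹ * φ (q⁻¹ • (y - z)) * (A * ENNReal.ofReal (r ^ (-(d:ℝ)/2)))) := by
        refine lintegral_mono fun z => ?_
        refine (mul_le_mul_left (hpt (y - z)) (h z)).trans ?_
        rw [add_mul]
        gcongr
        exact h2 z
    _ = ENNReal.ofReal q⁻¹ * (∫⁻ z, h z) + ENNReal.ofReal q⁻¹ * (∫⁻ z, φ (q⁻¹ • (y - z))) * (A * ENNReal.ofReal (r ^ (-(d:ℝ)/2))) := by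
        rw [lintegral_add_left (by fun_prop), lintegral_const_mul _ hm, lintegral_mul_const, lintegral_const_mul]
        · exact hφm.comp (by fun_prop)
        · exact (hφm.comp (by fun_prop)).const_mul _
    _ = ENNReal.ofReal q⁻¹ * (∫⁻ z, h z) + ENNReal.ofReal q⁻¹ * (ENNReal.ofReal (q ^ d) * J) * (A * ENNReal.ofReal (r ^ (-(d:ℝ)/2))) := by
        congr 3
        have hmm : Measurable (fun w : Euc d => φ (q⁻¹ • w)) := hφm.comp (by fun_prop)
        rw [lintegral_sub_left_eq_self (fun w => φ (q⁻¹ • w)) y,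
          lintegral_scale (f := fun w : Euc d => φ (q⁻¹ • w)) hq0 hmm]
        simp [smul_smul, inv_mul_cancel₀ hq0.ne', hJ]
    _ ≤ ENNReal.ofReal q⁻¹ * A + ENNReal.ofReal q⁻¹ * (ENNReal.ofReal (q ^ d) * J) * (A * ENNReal.ofReal (r ^ (-(d:ℝ)/2))) := by
        gcongr
    _ = ENNReal.ofReal q⁻¹ * A + ENNReal.ofReal q⁻¹ * A * J * (ENNReal.ofReal (q ^ d) * ENNReal.ofReal (r ^ (-(d:ℝ)/2))) := by
        ring
    _ = (1 + J) * A * ENNReal.ofReal q⁻¹ := by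
        have : q ^ d * r ^ (-(d:ℝ)/2) = 1 := by
          rw [hq, Real.sqrt_eq_rpow, ← Real.rpow_natCast, ← Real.rpow_mul hr.le, ← Real.rpow_add hr]
          ring_nf; simp
        rw [← ENNReal.ofReal_mul (by positivity), this]
        simp; ring

lemma beta_bound {s : ℝ} (hs : 0 < s) :
    ∫⁻ r in Set.Ioo 0 s, ENNReal.ofReal ((s - r) ^ (-(1:ℝ)/2)) * ENNReal.ofReal (r ^ (-(1:ℝ)/2)) ≤ 6 := by
  have hI : ∫⁻ r in Set.Ioo 0 s, ENNReal.ofReal (r ^ (-(1:ℝ)/2)) = ENNReal.ofReal (2 * s ^ ((1:ℝ)/2)) := by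
    rw [setLIntegral_congr Ioo_ae_eq_Ioc, ← ofReal_integral_eq_lintegral_ofReal]
    · rw [← intervalIntegral.integral_of_le hs.le, integral_rpow (by left; norm_num)]
      congr 1
      norm_num
      ring
    · have := intervalIntegral.intervalIntegrable_rpow' (a := 0) (b := s) (r := -(1:ℝ)/2) (by norm_num)
      exact (intervalIntegrable_iff_integrableOn_Ioc_of_le hs.le).1 this
    · rw [EventuallyLE, ae_restrict_iff' measurableSet_Ioc]
      exact ae_of_all _ fun r hr => by have := hr.1; simp only [Pi.zero_apply]; positivity
  have hI2 : ∫⁻ r in Set.Ioo 0 s, ENNReal.ofReal ((s - r) ^ (-(1:ℝ)/2)) = ENNReal.ofReal (2 * s ^ ((1:ℝ)/2)) := by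
    rw [← hI, ← lintegral_indicator measurableSet_Ioo, ← lintegral_indicator measurableSet_Ioo,
      ← lintegral_sub_left_eq_self _ s]
    congr 1; funext r
    by_cases h : r ∈ Set.Ioo 0 s
    · have h' : s - r ∈ Set.Ioo 0 s := ⟨by linarith [h.2], by linarith [h.1]⟩
      simp [Set.indicator_of_mem h, Set.indicator_of_mem h']
    · have h' : s - r ∉ Set.Ioo 0 s := fun h' => h ⟨by linarith [h'.2], by linarith [h'.1]⟩
      simp [Set.indicator_of_notMem h, Set.indicator_of_notMem h']
  calc _ ≤ ∫⁻ r in Set.Ioo 0 s, (ENNReal.ofReal ((s/2) ^ (-(1:ℝ)/2)) * ENNReal.ofReal (r ^ (-(1:ℝ)/2)) +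
          ENNReal.ofReal ((s/2) ^ (-(1:ℝ)/2)) * ENNReal.ofReal ((s - r) ^ (-(1:ℝ)/2))) := by
        refine setLIntegral_mono' measurableSet_Ioo fun r hr => ?_
        rcases le_total r (s/2) with h | h
        · refine le_trans ?_ le_self_add
          gcongr ?_ * _
          apply ENNReal.ofReal_le_ofReal
          exact Real.rpow_le_rpow_of_nonpos (by positivity) (by linarith) (by norm_num)
        · refine le_trans ?_ le_add_self
          rw [mul_comm]
          gcongr ?_ * _
          apply ENNReal.ofReal_le_ofReal
          exact Real.rpow_le_rpow_of_nonpos (by positivity) (by linarith) (by norm_num)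
    _ = ENNReal.ofReal ((s/2) ^ (-(1:ℝ)/2)) * ENNReal.ofReal (2 * s ^ ((1:ℝ)/2)) +
        ENNReal.ofReal ((s/2) ^ (-(1:ℝ)/2)) * ENNReal.ofReal (2 * s ^ ((1:ℝ)/2)) := by
        rw [lintegral_add_left (by fun_prop), lintegral_const_mul _ (by fun_prop),
          lintegral_const_mul _ (by fun_prop), hI, hI2]
    _ ≤ 6 := by
        rw [← ENNReal.ofReal_mul (by positivity), ← ENNReal.ofReal_add (by positivity) (by positivity)]
        have e6 : (6:ℝ≥0∞) = ENNReal.ofReal 6 := by simp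
        rw [e6]
        apply ENNReal.ofReal_le_ofReal
        rw [Real.div_rpow hs.le (by norm_num)]
        have e1 : s ^ (-(1:ℝ)/2) * s ^ ((1:ℝ)/2) = 1 := by
          rw [← Real.rpow_add hs]; norm_num
        have e2 : ((2:ℝ) ^ (-(1:ℝ)/2))⁻¹ ≤ 3/2 := by
          rw [← Real.rpow_neg (by norm_num)]
          have : -(-(1:ℝ)/2) = 1/2 := by norm_num
          rw [this, ← Real.sqrt_eq_rpow, Real.sqrt_le_left (by norm_num)]
          norm_num
        rw [div_eq_mul_inv]
        have e3 : s ^ (-(1:ℝ)/2) * (2 ^ (-(1:ℝ)/2))⁻¹ * (2 * s ^ ((1:ℝ)/2)) = 2 * ((2:ℝ) ^ (-(1:ℝ)/2))⁻¹ := by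
          calc _ = 2 * ((2:ℝ) ^ (-(1:ℝ)/2))⁻¹ * (s ^ (-(1:ℝ)/2) * s ^ ((1:ℝ)/2)) := by ring
            _ = _ := by rw [e1]; ring
        rw [e3]; linarith

end

section

lemma Gam_le {d : ℕ} {s : ℝ} (hs : 0 < s) (X : Euc d) : Gam s X ≤ s ^ (-(d:ℝ)/2) := by
  unfold Gam
  have : rexp (-‖X‖ ^ 2 / (16 * s)) ≤ 1 := by
    rw [Real.exp_le_one_iff]
    have : 0 ≤ ‖X‖ ^ 2 / (16 * s) := by positivity
    rw [neg_div]; linarith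
  have h2 : 0 ≤ s ^ (-(d:ℝ)/2) := by positivity
  nlinarith

lemma measurable_Gam_sub {d : ℕ} (s : ℝ) :
    Measurable (fun q : Euc d × Euc d => ENNReal.ofReal (Gam s (q.1 - q.2))) := by
  unfold Gam; fun_prop

lemma T_bound (d : ℕ) {C : ℝ} (hC : 0 < C) : ∃ C₄ : ℝ≥0∞, C₄ ≠ ⊤ ∧ ∀ (e e' : ℝ → Euc d → ℝ≥0∞)
    (A A' : ℝ≥0∞), MM e → MM e' → Nrm e A → Nrm e' A' → Nrm (TT C e e') (C₄ * A * A') := by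
  obtain ⟨C₂, hC₂, hG⟩ := lintegral_Gam d
  obtain ⟨C₃, hC₃, hK⟩ := exists_K_const d
  set W := ENNReal.ofReal ((2:ℝ) ^ ((d:ℝ)/2)) with hW
  have hW1 : 1 ≤ W := by
    rw [hW, ENNReal.one_le_ofReal]
    exact Real.one_le_rpow (by norm_num) (by positivity)
  refine ⟨ENNReal.ofReal C * C₃ * 6 * (1 + C₂) * W, ?_, ?_⟩
  · finiteness
  intro e e' A A' me me' hA hA' s hs
  set H : ℝ → Euc d → ℝ≥0∞ := fun r x => ∫⁻ y, ENNReal.ofReal (Gam (s - r) (x - y)) * e r y with hH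
  set b : ℝ → ℝ≥0∞ := fun r => ENNReal.ofReal ((s - r) ^ (-(1:ℝ)/2)) * ENNReal.ofReal (r ^ (-(1:ℝ)/2)) with hb
  have mer : ∀ r, Measurable (e r) := fun r => me.comp (f := fun x : Euc d => (r, x)) (by fun_prop)
  have mer' : ∀ r, Measurable (e' r) := fun r => me'.comp (f := fun x : Euc d => (r, x)) (by fun_prop)
  have key : ∀ x, TT C e e' s x ≤ ENNReal.ofReal C * C₃ * A' * ∫⁻ r in Set.Ioo 0 s, b r * H r x := by
    intro x
    unfold TT
    have mfun : Measurable (fun ω : ℝ × Euc d × Euc d => kmaj C s x ω * e ω.1 ω.2.1 * e' ω.1 ω.2.2) := by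
      have h1 : Measurable (fun q : ℝ × Euc d × Euc d => e q.1 q.2.1) :=
        me.comp (f := fun q : ℝ × Euc d × Euc d => (q.1, q.2.1)) (by fun_prop)
      have h2 : Measurable (fun q : ℝ × Euc d × Euc d => e' q.1 q.2.2) :=
        me'.comp (f := fun q : ℝ × Euc d × Euc d => (q.1, q.2.2)) (by fun_prop)
      have h3 : Measurable (fun q : ℝ × Euc d × Euc d => kmaj C s x q) :=
        (measurable_kmaj C).comp (f := fun q : ℝ × Euc d × Euc d => ((s, x), q)) (by fun_prop)
      exact (h3.mul h1).mul h2
    have mH : Measurable (fun r => b r * H r x) := by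
      have : Measurable (fun r => H r x) := by
        rw [hH]
        have h4 : Measurable (fun q : ℝ × Euc d => ENNReal.ofReal (Gam (s - q.1) (x - q.2)) * e q.1 q.2) := by
          refine Measurable.mul ?_ me
          unfold Gam; fun_prop
        exact h4.lintegral_prod_right'
      rw [hb]; fun_prop
    rw [← lintegral_const_mul _ mH, ← lintegral_indicator measurableSet_Ioo]
    rw [Measure.volume_eq_prod, lintegral_prod _ mfun.aemeasurable]
    refine lintegral_mono fun r => ?_
    by_cases hr : r ∈ Set.Ioo 0 s
    swap
    · have : ∀ y : Euc d × Euc d, kmaj C s x (r, y) = 0 := by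
        intro y; unfold kmaj; rw [if_neg]; exact hr
      simp [this]
    rw [Set.indicator_of_mem hr]
    have mfr : Measurable (fun y : Euc d × Euc d => kmaj C s x (r, y) * e r y.1 * e' r y.2) :=
      mfun.comp (f := fun y : Euc d × Euc d => (r, y)) (by fun_prop)
    show ∫⁻ y : Euc d × Euc d, kmaj C s x (r, y) * e r y.1 * e' r y.2 ≤ _
    rw [Measure.volume_eq_prod, lintegral_prod _ mfr.aemeasurable]
    have hm3 : Measurable (fun y => ENNReal.ofReal (Gam (s - r) (x - y)) * e r y) := by
      refine Measurable.mul ?_ (mer r)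
      unfold Gam; fun_prop
    have hE : ENNReal.ofReal C * C₃ * A' * (b r * H r x) =
        ∫⁻ y, (ENNReal.ofReal C * C₃ * A' * b r) * (ENNReal.ofReal (Gam (s - r) (x - y)) * e r y) := by
      rw [lintegral_const_mul _ hm3, hH]; ring
    rw [hE]
    refine lintegral_mono fun y => ?_
    have hk : ∀ z, kmaj C s x (r, y, z) * e r y * e' r z =
        (ENNReal.ofReal (C * (s - r) ^ (-(1:ℝ)/2)) * ENNReal.ofReal (Gam (s - r) (x - y)) * e r y) *
        (ENNReal.ofReal (Kn (y - z)) * e' r z) := by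
      intro z; unfold kmaj
      have hr' : 0 < (r, y, z).1 ∧ (r, y, z).1 < s := hr
      rw [if_pos hr']; ring
    simp only [hk]
    have hkm : Measurable (fun z => ENNReal.ofReal (Kn (y - z)) * e' r z) := by
      refine Measurable.mul ?_ (mer' r)
      exact ENNReal.measurable_ofReal.comp (measurable_Kn.comp (by fun_prop))
    rw [lintegral_const_mul _ hkm]
    have := hK (e' r) r A' (mer' r) hr.1 (hA' r hr.1).1 (hA' r hr.1).2 y
    calc _ ≤ (ENNReal.ofReal (C * (s - r) ^ (-(1:ℝ)/2)) * ENNReal.ofReal (Gam (s - r) (x - y)) * e r y) *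
          (C₃ * A' * ENNReal.ofReal (r ^ (-(1:ℝ)/2))) := by gcongr
      _ = _ := by rw [ENNReal.ofReal_mul hC.le, hb]; ring
  have hbb : ∫⁻ r in Set.Ioo 0 s, b r ≤ 6 := beta_bound hs
  have mb : Measurable b := by rw [hb]; fun_prop
  have hGx : ∀ r ∈ Set.Ioo 0 s, ∀ y : Euc d, ∫⁻ x, ENNReal.ofReal (Gam (s - r) (x - y)) = C₂ := by
    intro r hr y
    rw [lintegral_sub_right_eq_self (fun w => ENNReal.ofReal (Gam (s - r) w)) y]
    exact hG _ (by linarith [hr.2])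
  have hGy : ∀ r ∈ Set.Ioo 0 s, ∀ x : Euc d, ∫⁻ y, ENNReal.ofReal (Gam (s - r) (x - y)) = C₂ := by
    intro r hr x
    rw [lintegral_sub_left_eq_self (fun w => ENNReal.ofReal (Gam (s - r) w)) x]
    exact hG _ (by linarith [hr.2])
  constructor
  · calc ∫⁻ x, TT C e e' s x ≤ ∫⁻ x, ENNReal.ofReal C * C₃ * A' * ∫⁻ r in Set.Ioo 0 s, b r * H r x :=
          lintegral_mono key
      _ = ENNReal.ofReal C * C₃ * A' * ∫⁻ r in Set.Ioo 0 s, b r * ∫⁻ x, H r x := by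
        have m2 : Measurable (fun q : Euc d × ℝ => b q.2 * H q.2 q.1) := by
          refine Measurable.mul (mb.comp measurable_snd) ?_
          have h4 : Measurable (fun q : (Euc d × ℝ) × Euc d => ENNReal.ofReal (Gam (s - q.1.2) (q.1.1 - q.2)) * e q.1.2 q.2) := by
            refine Measurable.mul ?_ (me.comp (f := fun q : (Euc d × ℝ) × Euc d => (q.1.2, q.2)) (by fun_prop))
            unfold Gam; fun_prop
          exact h4.lintegral_prod_right'
        rw [lintegral_const_mul _ m2.lintegral_prod_right']
        congr 1
        rw [lintegral_lintegral_swap m2.aemeasurable]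
        refine lintegral_congr fun r => ?_
        show ∫⁻ x, b r * H r x = _
        rw [lintegral_const_mul]
        exact Measurable.lintegral_prod_right' (f := fun q : Euc d × Euc d => ENNReal.ofReal (Gam (s - r) (q.1 - q.2)) * e r q.2)
          ((measurable_Gam_sub _).mul ((mer r).comp measurable_snd))
      _ ≤ ENNReal.ofReal C * C₃ * A' * ∫⁻ r in Set.Ioo 0 s, b r * (C₂ * A) := by
        refine mul_le_mul_right ?_ _
        refine setLIntegral_mono' measurableSet_Ioo fun r hr => ?_
        gcongr
        rw [hH]
        rw [lintegral_lintegral_swap]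
        · have : ∀ y, ∫⁻ x, ENNReal.ofReal (Gam (s - r) (x - y)) * e r y = C₂ * e r y := by
            intro y
            rw [lintegral_mul_const, hGx r hr]
            unfold Gam; fun_prop
          simp only [this]
          rw [lintegral_const_mul _ (mer r)]
          gcongr
          exact (hA r hr.1).1
        · exact ((measurable_Gam_sub _).mul ((mer r).comp measurable_snd)).aemeasurable
      _ = ENNReal.ofReal C * C₃ * A' * ((∫⁻ r in Set.Ioo 0 s, b r) * (C₂ * A)) := by
        rw [lintegral_mul_const _ mb]
      _ ≤ ENNReal.ofReal C * C₃ * A' * (6 * ((1 + C₂) * A)) * 1 := by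
        rw [mul_one]
        gcongr
        exact le_add_self
      _ ≤ ENNReal.ofReal C * C₃ * A' * (6 * ((1 + C₂) * A)) * W := by gcongr
      _ = _ := by ring
  · intro x
    have hhalf : ENNReal.ofReal ((s/2) ^ (-(d:ℝ)/2)) = W * ENNReal.ofReal (s ^ (-(d:ℝ)/2)) := by
      rw [hW, ← ENNReal.ofReal_mul (by positivity), Real.div_rpow hs.le (by norm_num)]
      congr 1
      rw [div_eq_mul_inv, ← Real.rpow_neg (by norm_num), mul_comm]
      congr 2; ring
    have hHb : ∀ r ∈ Set.Ioo 0 s, H r x ≤ (1 + C₂) * A * (W * ENNReal.ofReal (s ^ (-(d:ℝ)/2))) := by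
      intro r hr
      rw [← hhalf]
      rcases le_total r (s/2) with h | h
      · calc H r x ≤ ∫⁻ y, ENNReal.ofReal ((s/2) ^ (-(d:ℝ)/2)) * e r y := by
              refine lintegral_mono fun y => ?_
              gcongr
              refine (Gam_le (by linarith [hr.2]) _).trans ?_
              exact Real.rpow_le_rpow_of_nonpos (by positivity) (by linarith)
                (by have : (0:ℝ) ≤ d := by positivity
                    linarith)
          _ ≤ ENNReal.ofReal ((s/2) ^ (-(d:ℝ)/2)) * (1 * A) := by
              rw [lintegral_const_mul _ (mer r), one_mul]
              gcongr
              exact (hA r hr.1).1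
          _ ≤ ENNReal.ofReal ((s/2) ^ (-(d:ℝ)/2)) * ((1 + C₂) * A) := by
              gcongr; exact le_self_add
          _ = _ := by ring
      · calc H r x ≤ ∫⁻ y, ENNReal.ofReal (Gam (s - r) (x - y)) * (A * ENNReal.ofReal ((s/2) ^ (-(d:ℝ)/2))) := by
              refine lintegral_mono fun y => ?_
              gcongr
              refine ((hA r hr.1).2 y).trans ?_
              refine mul_le_mul_right (ENNReal.ofReal_le_ofReal ?_) _
              exact Real.rpow_le_rpow_of_nonpos (by positivity) (by linarith)
                (by have : (0:ℝ) ≤ d := by positivity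
                    linarith)
          _ = C₂ * (A * ENNReal.ofReal ((s/2) ^ (-(d:ℝ)/2))) := by
              rw [lintegral_mul_const, hGy r hr]
              unfold Gam; fun_prop
          _ ≤ (1 + C₂) * (A * ENNReal.ofReal ((s/2) ^ (-(d:ℝ)/2))) := by
              gcongr; exact le_add_self
          _ = _ := by ring
    calc TT C e e' s x ≤ _ := key x
      _ ≤ ENNReal.ofReal C * C₃ * A' * ∫⁻ r in Set.Ioo 0 s, b r * ((1 + C₂) * A * (W * ENNReal.ofReal (s ^ (-(d:ℝ)/2)))) := by
        refine mul_le_mul_right ?_ _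
        refine setLIntegral_mono' measurableSet_Ioo fun r hr => ?_
        gcongr
        exact hHb r hr
      _ ≤ ENNReal.ofReal C * C₃ * A' * (6 * ((1 + C₂) * A * (W * ENNReal.ofReal (s ^ (-(d:ℝ)/2))))) := by
        rw [lintegral_mul_const _ mb]
        gcongr
      _ = _ := by ring

end

section

def Lc {d : ℕ} (f : Euc d → ℝ) (p : PP d) (s : ℝ) (x : Euc d) : ℂ :=
  ∫ y, Gc p s (x - y) * (f y : ℂ)

def BB {d : ℕ} (p : PP d) (g h : ℝ → Euc d → ℂ) (s : ℝ) (x : Euc d) : ℂ :=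
  ∫ ω : ℝ × Euc d × Euc d, Ker p s x ω * g ω.1 ω.2.1 * h ω.1 ω.2.2

def vv {d : ℕ} (f : Euc d → ℝ) : ℕ → PP d → ℝ → Euc d → ℂ
  | 0 => fun _ _ _ => 0
  | m + 1 => fun p s x => Lc f p s x - BB p (vv f m p) (vv f m p) s x

def e0 {d : ℕ} (C : ℝ) (f : Euc d → ℝ) (s : ℝ) (x : Euc d) : ℝ≥0∞ :=
  ∫⁻ y, ENNReal.ofReal (C * Gam s (x - y)) * ‖f y‖ₑ

def EE {d : ℕ} (C : ℝ) (f : Euc d → ℝ) : ℕ → ℝ → Euc d → ℝ≥0∞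
  | 0 => fun _ _ => 0
  | m + 1 => fun s x => e0 C f s x + TT C (EE C f m) (EE C f m) s x

def DD {d : ℕ} (C : ℝ) (f : Euc d → ℝ) : ℕ → ℝ → Euc d → ℝ≥0∞
  | 0 => e0 C f
  | m + 1 => fun s x => TT C (DD C f m) (EE C f (m+1)) s x + TT C (EE C f m) (DD C f m) s x

def Einf {d : ℕ} (C : ℝ) (f : Euc d → ℝ) (s : ℝ) (x : Euc d) : ℝ≥0∞ := ∑' m, DD C f m s x

structure Dat {d : ℕ} (C : ℝ) (f : Euc d → ℝ) (a : ℝ≥0∞) : Prop where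
  hC : 0 < C
  hG : ∀ (p : PP d) (s : ℝ) (X : Euc d), 0 < s → p ∈ Adm d s → ‖Gc p s X‖ₑ ≤ ENNReal.ofReal (C * Gam s X)
  hK : ∀ (p : PP d) (s : ℝ) (x : Euc d) (ω : ℝ × Euc d × Euc d), p ∈ Adm d s → ‖Ker p s x ω‖ₑ ≤ kmaj C s x ω
  fm : Measurable f
  n0 : Nrm (e0 C f) a
  ha : a ≠ ⊤
  T : ∃ C₄ : ℝ≥0∞, C₄ ≠ ⊤ ∧ 4 * C₄ * a ≤ 2⁻¹ ∧ ∀ (e e' : ℝ → Euc d → ℝ≥0∞)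
    (A A' : ℝ≥0∞), MM e → MM e' → Nrm e A → Nrm e' A' → Nrm (TT C e e') (C₄ * A * A')

lemma Nrm.add {d : ℕ} {e e' : ℝ → Euc d → ℝ≥0∞} {A A' : ℝ≥0∞} (he : MM e) (h : Nrm e A) (h' : Nrm e' A') :
    Nrm (fun s x => e s x + e' s x) (A + A') := by
  intro s hs
  have mer : Measurable (e s) := he.comp (f := fun x : Euc d => (s, x)) (by fun_prop)
  constructor
  · rw [lintegral_add_left mer]
    exact add_le_add (h s hs).1 (h' s hs).1
  · intro x
    rw [add_mul]
    exact add_le_add ((h s hs).2 x) ((h' s hs).2 x)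

lemma Nrm.mono {d : ℕ} {e : ℝ → Euc d → ℝ≥0∞} {A A' : ℝ≥0∞} (h : Nrm e A) (hA : A ≤ A') : Nrm e A' := by
  intro s hs
  refine ⟨(h s hs).1.trans hA, fun x => ((h s hs).2 x).trans ?_⟩
  gcongr

lemma Nrm.lt_top {d : ℕ} {e : ℝ → Euc d → ℝ≥0∞} {A : ℝ≥0∞} (h : Nrm e A) (hA : A ≠ ⊤) {s : ℝ}
    (hs : 0 < s) (x : Euc d) : e s x < ⊤ :=
  lt_of_le_of_lt ((h s hs).2 x) (by finiteness)

lemma MM_e0 {d : ℕ} {C : ℝ} {f : Euc d → ℝ} (hf : Measurable f) : MM (e0 C f) := by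
  unfold MM e0
  have h4 : Measurable (fun q : (ℝ × Euc d) × Euc d => ENNReal.ofReal (C * Gam q.1.1 (q.1.2 - q.2)) * ‖f q.2‖ₑ) := by
    have h5 : Measurable (fun q : (ℝ × Euc d) × Euc d => ENNReal.ofReal (C * Gam q.1.1 (q.1.2 - q.2))) := by
      unfold Gam; fun_prop
    exact h5.mul (hf.comp measurable_snd).enorm
  exact h4.lintegral_prod_right'

lemma MM.add {d : ℕ} {e e' : ℝ → Euc d → ℝ≥0∞} (he : MM e) (he' : MM e') :
    MM (fun s x => e s x + e' s x) := Measurable.add he he'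

lemma e0_nrm (d : ℕ) {C : ℝ} (hC : 0 < C) : ∃ C₅ : ℝ≥0∞, C₅ ≠ ⊤ ∧ ∀ f : Euc d → ℝ, Measurable f →
    Nrm (e0 C f) (C₅ * ∫⁻ y, ‖f y‖ₑ) := by
  obtain ⟨C₂, hC₂, hG⟩ := lintegral_Gam d
  refine ⟨ENNReal.ofReal C * (1 + C₂), by finiteness, fun f hf s hs => ⟨?_, fun x => ?_⟩⟩
  · unfold e0
    rw [lintegral_lintegral_swap]
    · have : ∀ y, ∫⁻ x, ENNReal.ofReal (C * Gam s (x - y)) * ‖f y‖ₑ = ENNReal.ofReal C * C₂ * ‖f y‖ₑ := by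
        intro y
        have hm : Measurable (fun x : Euc d => ENNReal.ofReal (Gam s (x - y))) := by unfold Gam; fun_prop
        simp_rw [ENNReal.ofReal_mul hC.le]
        rw [lintegral_mul_const _ (by fun_prop), lintegral_const_mul _ hm,
          lintegral_sub_right_eq_self (fun w => ENNReal.ofReal (Gam s w)) y, hG s hs]
      simp only [this]
      rw [lintegral_const_mul _ (by fun_prop)]
      gcongr
      exact le_add_self
    · apply Measurable.aemeasurable
      have h5 : Measurable (fun q : Euc d × Euc d => ENNReal.ofReal (C * Gam s (q.1 - q.2))) := by
        unfold Gam; fun_prop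
      exact h5.mul (hf.comp measurable_snd).enorm
  · unfold e0
    calc _ ≤ ∫⁻ y, ENNReal.ofReal (C * s ^ (-(d:ℝ)/2)) * ‖f y‖ₑ := by
          refine lintegral_mono fun y => ?_
          gcongr
          exact Gam_le hs _
      _ = ENNReal.ofReal C * 1 * (∫⁻ y, ‖f y‖ₑ) * ENNReal.ofReal (s ^ (-(d:ℝ)/2)) := by
          rw [lintegral_const_mul _ (by fun_prop), ENNReal.ofReal_mul hC.le]; ring
      _ ≤ _ := by gcongr; exact le_self_add

namespace Dat
variable {d : ℕ} {C : ℝ} {f : Euc d → ℝ} {a : ℝ≥0∞}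

lemma mEE (D : Dat C f a) (m : ℕ) : MM (EE C f m) := by
  induction m with
  | zero => exact measurable_const
  | succ m ih => exact (MM_e0 D.fm).add (ih.TT ih)

lemma mDD (D : Dat C f a) (m : ℕ) : MM (DD C f m) := by
  induction m with
  | zero => exact MM_e0 D.fm
  | succ m ih => exact (ih.TT (D.mEE _)).add ((D.mEE _).TT ih)

lemma nEE (D : Dat C f a) (m : ℕ) : Nrm (EE C f m) (2 * a) := by
  obtain ⟨C₄, hC₄, h4, hT⟩ := D.T
  induction m with
  | zero => intro s hs; simp [EE]
  | succ m ih =>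
    refine (Nrm.add (MM_e0 D.fm) D.n0 (hT _ _ _ _ (D.mEE m) (D.mEE m) ih ih)).mono ?_
    calc a + C₄ * (2 * a) * (2 * a) = a + (4 * C₄ * a) * a := by ring
      _ ≤ a + 1 * a := by
        gcongr
        exact h4.trans (by simp)
      _ = 2 * a := by ring

lemma nDD (D : Dat C f a) (m : ℕ) : Nrm (DD C f m) (a * 2⁻¹ ^ m) := by
  obtain ⟨C₄, hC₄, h4, hT⟩ := D.T
  induction m with
  | zero => simpa [DD] using D.n0
  | succ m ih =>
    refine (Nrm.add ((D.mDD m).TT (D.mEE _)) (hT _ _ _ _ (D.mDD m) (D.mEE (m+1)) ih (D.nEE _))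
      (hT _ _ _ _ (D.mEE m) (D.mDD m) (D.nEE _) ih)).mono ?_
    calc C₄ * (a * 2⁻¹ ^ m) * (2 * a) + C₄ * (2 * a) * (a * 2⁻¹ ^ m) = (4 * C₄ * a) * (a * 2⁻¹ ^ m) := by ring
      _ ≤ 2⁻¹ * (a * 2⁻¹ ^ m) := by gcongr
      _ = _ := by ring

lemma mEinf (D : Dat C f a) : MM (Einf C f) := Measurable.ennreal_tsum fun m => D.mDD m

lemma tsum_half (a : ℝ≥0∞) : ∑' m : ℕ, a * 2⁻¹ ^ m = 2 * a := by
  rw [ENNReal.tsum_mul_left, ENNReal.tsum_geometric, ENNReal.one_sub_inv_two, inv_inv, mul_comm]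

lemma nEinf (D : Dat C f a) : Nrm (Einf C f) (2 * a) := by
  intro s hs
  constructor
  · unfold Einf
    rw [lintegral_tsum, ← tsum_half]
    · exact ENNReal.tsum_le_tsum fun m => (D.nDD m s hs).1
    · intro m
      exact ((D.mDD m).comp (f := fun x : Euc d => (s, x)) (by fun_prop)).aemeasurable
  · intro x
    unfold Einf
    rw [← tsum_half, ← ENNReal.tsum_mul_right]
    exact ENNReal.tsum_le_tsum fun m => (D.nDD m s hs).2 x

lemma Einf_lt_top (D : Dat C f a) {s : ℝ} (hs : 0 < s) (x : Euc d) : Einf C f s x < ⊤ :=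
  D.nEinf.lt_top (by have := D.ha; finiteness) hs x

lemma TT_Einf_lt_top (D : Dat C f a) {s : ℝ} (hs : 0 < s) (x : Euc d) :
    TT C (Einf C f) (Einf C f) s x < ⊤ := by
  obtain ⟨C₄, hC₄, h4, hT⟩ := D.T
  exact (hT _ _ _ _ D.mEinf D.mEinf D.nEinf D.nEinf).lt_top (by have := D.ha; finiteness) hs x

end Dat

def MC {d : ℕ} (g : ℝ → Euc d → ℂ) : Prop := Measurable (fun q : ℝ × Euc d => g q.1 q.2)

lemma MC.ker {d : ℕ} {g h : ℝ → Euc d → ℂ} (hg : MC g) (hh : MC h) (p : PP d) :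
    Measurable (fun q : (ℝ × Euc d) × (ℝ × Euc d × Euc d) =>
      Ker p q.1.1 q.1.2 q.2 * g q.2.1 q.2.2.1 * h q.2.1 q.2.2.2) := by
  have h1 : Measurable (fun q : (ℝ × Euc d) × (ℝ × Euc d × Euc d) => g q.2.1 q.2.2.1) :=
    hg.comp (f := fun q : (ℝ × Euc d) × (ℝ × Euc d × Euc d) => (q.2.1, q.2.2.1)) (by fun_prop)
  have h2 : Measurable (fun q : (ℝ × Euc d) × (ℝ × Euc d × Euc d) => h q.2.1 q.2.2.2) :=
    hh.comp (f := fun q : (ℝ × Euc d) × (ℝ × Euc d × Euc d) => (q.2.1, q.2.2.2)) (by fun_prop)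
  exact ((measurable_Ker p).mul h1).mul h2

lemma MC.ker' {d : ℕ} {g h : ℝ → Euc d → ℂ} (hg : MC g) (hh : MC h) (p : PP d) (s : ℝ) (x : Euc d) :
    Measurable (fun ω : ℝ × Euc d × Euc d => Ker p s x ω * g ω.1 ω.2.1 * h ω.1 ω.2.2) :=
  (hg.ker hh p).comp (f := fun ω : ℝ × Euc d × Euc d => ((s, x), ω)) (by fun_prop)

lemma MC.BB {d : ℕ} {g h : ℝ → Euc d → ℂ} (hg : MC g) (hh : MC h) (p : PP d) : MC (BB p g h) :=
  (hg.ker hh p).stronglyMeasurable.integral_prod_right'.measurable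

lemma MC_Lc {d : ℕ} {f : Euc d → ℝ} (hf : Measurable f) (p : PP d) : MC (Lc f p) := by
  have h1 : Measurable (fun q : (ℝ × Euc d) × Euc d => Gc p q.1.1 (q.1.2 - q.2) * (f q.2 : ℂ)) := by
    refine Measurable.mul ((measurable_Gc p).comp (f := fun q : (ℝ × Euc d) × Euc d => (q.1.1, q.1.2 - q.2)) (by fun_prop)) (by fun_prop)
  exact h1.stronglyMeasurable.integral_prod_right'.measurable

lemma MC_vv {d : ℕ} {f : Euc d → ℝ} (hf : Measurable f) (m : ℕ) (p : PP d) : MC (vv f m p) := by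
  induction m with
  | zero => exact measurable_const
  | succ m ih => exact (MC_Lc hf p).sub (ih.BB ih p)

namespace Dat
variable {d : ℕ} {C : ℝ} {f : Euc d → ℝ} {a : ℝ≥0∞}

lemma ker_le (D : Dat C f a) {p : PP d} {s : ℝ} (hp : p ∈ Adm d s) (x : Euc d)
    {g h : ℝ → Euc d → ℂ} {e e' : ℝ → Euc d → ℝ≥0∞}
    (hg : ∀ r, 0 < r → r < s → ∀ y, ‖g r y‖ₑ ≤ e r y) (hh : ∀ r, 0 < r → r < s → ∀ y, ‖h r y‖ₑ ≤ e' r y)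
    (ω : ℝ × Euc d × Euc d) :
    ‖Ker p s x ω * g ω.1 ω.2.1 * h ω.1 ω.2.2‖ₑ ≤ kmaj C s x ω * e ω.1 ω.2.1 * e' ω.1 ω.2.2 := by
  by_cases hω : 0 < ω.1 ∧ ω.1 < s
  · rw [enorm_mul, enorm_mul]
    gcongr
    · exact D.hK p s x ω hp
    · exact hg _ hω.1 hω.2 _
    · exact hh _ hω.1 hω.2 _
  · have : Ker p s x ω = 0 := by unfold Ker; rw [if_neg hω]
    simp [this]

lemma BB_le (D : Dat C f a) {p : PP d} {s : ℝ} (hp : p ∈ Adm d s) (x : Euc d)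
    {g h : ℝ → Euc d → ℂ} {e e' : ℝ → Euc d → ℝ≥0∞}
    (hg : ∀ r, 0 < r → r < s → ∀ y, ‖g r y‖ₑ ≤ e r y) (hh : ∀ r, 0 < r → r < s → ∀ y, ‖h r y‖ₑ ≤ e' r y) :
    ‖BB p g h s x‖ₑ ≤ TT C e e' s x :=
  (enorm_integral_le_lintegral_enorm _).trans (lintegral_mono fun ω => D.ker_le hp x hg hh ω)

lemma ker_int (D : Dat C f a) {p : PP d} {s : ℝ} (hp : p ∈ Adm d s) (x : Euc d)
    {g h : ℝ → Euc d → ℂ} {e e' : ℝ → Euc d → ℝ≥0∞} (mg : MC g) (mh : MC h)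
    (hg : ∀ r, 0 < r → r < s → ∀ y, ‖g r y‖ₑ ≤ e r y) (hh : ∀ r, 0 < r → r < s → ∀ y, ‖h r y‖ₑ ≤ e' r y)
    (ht : TT C e e' s x < ⊤) :
    Integrable (fun ω : ℝ × Euc d × Euc d => Ker p s x ω * g ω.1 ω.2.1 * h ω.1 ω.2.2) :=
  ⟨(mg.ker' mh p s x).aestronglyMeasurable,
    lt_of_le_of_lt (lintegral_mono fun ω => D.ker_le hp x hg hh ω) ht⟩

lemma TT_lt_top (D : Dat C f a) {e e' : ℝ → Euc d → ℝ≥0∞} {A A' : ℝ≥0∞} (me : MM e) (me' : MM e')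
    (h : Nrm e A) (h' : Nrm e' A') (hA : A ≠ ⊤) (hA' : A' ≠ ⊤) {s : ℝ} (hs : 0 < s) (x : Euc d) :
    TT C e e' s x < ⊤ := by
  obtain ⟨C₄, hC₄, h4, hT⟩ := D.T
  exact (hT _ _ _ _ me me' h h').lt_top (by finiteness) hs x

lemma Lc_le (D : Dat C f a) {p : PP d} {s : ℝ} (hs : 0 < s) (hp : p ∈ Adm d s) (x : Euc d) :
    ‖Lc f p s x‖ₑ ≤ e0 C f s x := by
  refine (enorm_integral_le_lintegral_enorm _).trans (lintegral_mono fun y => ?_)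
  rw [enorm_mul]
  gcongr
  · exact D.hG p s _ hs hp
  · simp [enorm_eq_nnnorm]

lemma vv_le (D : Dat C f a) (m : ℕ) {p : PP d} {s : ℝ} (hs : 0 < s) (hp : p ∈ Adm d s) (x : Euc d) :
    ‖vv f m p s x‖ₑ ≤ EE C f m s x := by
  induction m generalizing s x with
  | zero => simp [vv, EE]
  | succ m ih =>
    refine (enorm_sub_le).trans (add_le_add (D.Lc_le hs hp x) (D.BB_le hp x ?_ ?_))
    · exact fun r hr hrs y => ih hr (Adm_mono hrs.le hp) y
    · exact fun r hr hrs y => ih hr (Adm_mono hrs.le hp) y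

lemma ww_le (D : Dat C f a) (m : ℕ) {p : PP d} {s : ℝ} (hs : 0 < s) (hp : p ∈ Adm d s) (x : Euc d) :
    ‖vv f (m+1) p s x - vv f m p s x‖ₑ ≤ DD C f m s x := by
  induction m generalizing s x with
  | zero =>
    have : vv f (0+1) p s x - vv f 0 p s x = Lc f p s x := by
      simp [vv, BB]
    rw [this]; exact D.Lc_le hs hp x
  | succ m ih =>
    have ha := D.ha
    have hD : ∀ r, 0 < r → r < s → ∀ y, ‖vv f (m+1) p r y - vv f m p r y‖ₑ ≤ DD C f m r y :=
      fun r hr hrs y => ih hr (Adm_mono hrs.le hp) y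
    have hv : ∀ n, ∀ r, 0 < r → r < s → ∀ y, ‖vv f n p r y‖ₑ ≤ EE C f n r y :=
      fun n r hr hrs y => D.vv_le n hr (Adm_mono hrs.le hp) y
    have mw : MC (fun r y => vv f (m+1) p r y - vv f m p r y) := (MC_vv D.fm _ p).sub (MC_vv D.fm _ p)
    have i1 := D.ker_int hp x mw (MC_vv D.fm (m+1) p) hD (hv (m+1))
      (D.TT_lt_top (D.mDD m) (D.mEE _) (D.nDD m) (D.nEE _) (by finiteness) (by finiteness) hs x)
    have i2 := D.ker_int hp x (MC_vv D.fm m p) mw (hv m) hD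
      (D.TT_lt_top (D.mEE m) (D.mDD m) (D.nEE m) (D.nDD _) (by finiteness) (by finiteness) hs x)
    have i3 := D.ker_int hp x (MC_vv D.fm m p) (MC_vv D.fm m p) (hv m) (hv m)
      (D.TT_lt_top (D.mEE m) (D.mEE m) (D.nEE m) (D.nEE _) (by finiteness) (by finiteness) hs x)
    have i4 := D.ker_int hp x (MC_vv D.fm (m+1) p) (MC_vv D.fm (m+1) p) (hv _) (hv _)
      (D.TT_lt_top (D.mEE _) (D.mEE _) (D.nEE _) (D.nEE _) (by finiteness) (by finiteness) hs x)
    have key : vv f (m+1+1) p s x - vv f (m+1) p s x =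
        -(BB p (fun r y => vv f (m+1) p r y - vv f m p r y) (vv f (m+1) p) s x +
          BB p (vv f m p) (fun r y => vv f (m+1) p r y - vv f m p r y) s x) := by
      have e1 : vv f (m+1+1) p s x = Lc f p s x - BB p (vv f (m+1) p) (vv f (m+1) p) s x := rfl
      have e2 : vv f (m+1) p s x = Lc f p s x - BB p (vv f m p) (vv f m p) s x := rfl
      rw [e1, e2]
      have e3 : BB p (vv f (m+1) p) (vv f (m+1) p) s x - BB p (vv f m p) (vv f m p) s x =
        BB p (fun r y => vv f (m+1) p r y - vv f m p r y) (vv f (m+1) p) s x +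
          BB p (vv f m p) (fun r y => vv f (m+1) p r y - vv f m p r y) s x := by
        unfold BB
        rw [← integral_sub i4 i3, ← integral_add i1 i2]
        congr 1; funext ω; ring
      rw [← e3]; ring
    rw [key, enorm_neg]
    exact (enorm_add_le _ _).trans (add_le_add (D.BB_le hp x hD (hv _)) (D.BB_le hp x (hv _) hD))

end Dat
end

section

def vinf {d : ℕ} (f : Euc d → ℝ) (p : PP d) (s : ℝ) (x : Euc d) : ℂ :=
  ∑' m, (vv f (m+1) p s x - vv f m p s x)

lemma hol_Gc {d : ℕ} {s t : ℝ} (hs : 0 < s) (X : Euc d) :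
    DifferentiableOn ℂ (fun p : PP d => Gc p s X) (Adm d t) := by
  intro p hp
  have h0 := (mu_bounds hp.2).2.2.2
  have hsl : p.2 ∈ Complex.slitPlane := by
    left
    have := (abs_le.1 (Complex.abs_re_le_norm (p.2 - 1))).1
    have h2 := hp.2
    simp at this; linarith
  have hs' : (s:ℂ) ≠ 0 := by exact_mod_cast hs.ne'
  apply DifferentiableAt.differentiableWithinAt
  unfold Gc
  have h1 : DifferentiableAt ℂ (fun p : PP d => p.2 ^ (((-(d:ℝ)/2 : ℝ)) : ℂ)) p :=
    (differentiableAt_snd).cpow (differentiableAt_const _) hsl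
  have h2 : DifferentiableAt ℂ (fun p : PP d => -(∑ i, ((X i : ℂ) + s * p.1 i) ^ 2) / (4 * s * p.2)) p := by
    have e : (fun p : PP d => -(∑ i, ((X i : ℂ) + s * p.1 i) ^ 2) / (4 * s * p.2)) =
        fun p : PP d => -(∑ i, ((X i : ℂ) + s * p.1 i) ^ 2) * (4 * s * p.2)⁻¹ := by
      funext p; rw [div_eq_mul_inv]
    rw [e]
    apply DifferentiableAt.mul
    · fun_prop
    · apply DifferentiableAt.inv
      · fun_prop
      · simp [h0, hs']
  exact (h1.const_mul _).mul h2.cexp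

lemma hol_Ker {d : ℕ} {s t : ℝ} (x : Euc d) (ω : ℝ × Euc d × Euc d) :
    DifferentiableOn ℂ (fun p : PP d => Ker p s x ω) (Adm d t) := by
  by_cases hω : 0 < ω.1 ∧ ω.1 < s
  · unfold Ker
    simp only [if_pos hω]
    have hG : DifferentiableOn ℂ (fun p : PP d => Gc p (s - ω.1) (x - ω.2.1)) (Adm d t) :=
      hol_Gc (by linarith [hω.2]) _
    refine DifferentiableOn.fun_sum fun i _ => ?_
    refine (DifferentiableOn.mul ?_ hG).mul_const _
    simp only [div_eq_mul_inv]
    apply DifferentiableOn.mul_const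
    fun_prop
  · have h : (fun p : PP d => Ker p s x ω) = fun p => 0 := by
      funext p; unfold Ker; rw [if_neg hω]
    rw [h]; fun_prop

namespace Dat
variable {d : ℕ} {C : ℝ} {f : Euc d → ℝ} {a : ℝ≥0∞}

lemma hasSum_vinf (D : Dat C f a) {p : PP d} {s : ℝ} (hs : 0 < s) (hp : p ∈ Adm d s) (x : Euc d) :
    HasSum (fun m => vv f (m+1) p s x - vv f m p s x) (vinf f p s x) := by
  have hfin := (D.Einf_lt_top hs x).ne
  have h1 := ENNReal.summable_toReal hfin
  refine Summable.hasSum (Summable.of_norm_bounded h1 fun m => ?_)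
  have := ENNReal.toReal_mono (ENNReal.ne_top_of_tsum_ne_top hfin m) (D.ww_le m hs hp x)
  simpa using this

lemma sum_vv (f : Euc d → ℝ) (p : PP d) (s : ℝ) (x : Euc d) (n : ℕ) :
    ∑ m ∈ Finset.range n, (vv f (m+1) p s x - vv f m p s x) = vv f n p s x := by
  rw [Finset.sum_range_sub (fun m => vv f m p s x)]; simp [vv]

lemma tendsto_vv (D : Dat C f a) {p : PP d} {s : ℝ} (hs : 0 < s) (hp : p ∈ Adm d s) (x : Euc d) :
    Tendsto (fun n => vv f n p s x) atTop (𝓝 (vinf f p s x)) := by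
  have := (D.hasSum_vinf hs hp x).tendsto_sum_nat
  simpa only [sum_vv] using this

lemma vv_le_Einf (D : Dat C f a) (n : ℕ) {p : PP d} {s : ℝ} (hs : 0 < s) (hp : p ∈ Adm d s) (x : Euc d) :
    ‖vv f n p s x‖ₑ ≤ Einf C f s x := by
  rw [← sum_vv]
  refine (enorm_sum_le _ _).trans ?_
  refine (Finset.sum_le_sum fun m _ => D.ww_le m hs hp x).trans ?_
  exact ENNReal.sum_le_tsum _

lemma vinf_le (D : Dat C f a) {p : PP d} {s : ℝ} (hs : 0 < s) (hp : p ∈ Adm d s) (x : Euc d) :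
    ‖vinf f p s x‖ₑ ≤ Einf C f s x :=
  le_of_tendsto ((continuous_enorm.tendsto _).comp (D.tendsto_vv hs hp x))
    (Eventually.of_forall fun n => D.vv_le_Einf n hs hp x)

lemma tendsto_ker (D : Dat C f a) {p : PP d} {s : ℝ} (hp : p ∈ Adm d s) (x : Euc d)
    (ω : ℝ × Euc d × Euc d) :
    Tendsto (fun n => Ker p s x ω * vv f n p ω.1 ω.2.1 * vv f n p ω.1 ω.2.2) atTop
      (𝓝 (Ker p s x ω * vinf f p ω.1 ω.2.1 * vinf f p ω.1 ω.2.2)) := by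
  by_cases hω : 0 < ω.1 ∧ ω.1 < s
  · have hp' := Adm_mono hω.2.le hp
    exact ((tendsto_const_nhds).mul (D.tendsto_vv hω.1 hp' _)).mul (D.tendsto_vv hω.1 hp' _)
  · have : Ker p s x ω = 0 := by unfold Ker; rw [if_neg hω]
    simp [this]

lemma meas_ker_inf (D : Dat C f a) {p : PP d} {s : ℝ} (hp : p ∈ Adm d s) (x : Euc d) :
    Measurable (fun ω : ℝ × Euc d × Euc d => Ker p s x ω * vinf f p ω.1 ω.2.1 * vinf f p ω.1 ω.2.2) :=
  measurable_of_tendsto_metrizable (fun n => (MC_vv D.fm n p).ker' (MC_vv D.fm n p) p s x)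
    (tendsto_pi_nhds.2 fun ω => D.tendsto_ker hp x ω)

lemma int_ker_inf (D : Dat C f a) {p : PP d} {s : ℝ} (hs : 0 < s) (hp : p ∈ Adm d s) (x : Euc d) :
    Integrable (fun ω : ℝ × Euc d × Euc d => Ker p s x ω * vinf f p ω.1 ω.2.1 * vinf f p ω.1 ω.2.2) := by
  refine ⟨(D.meas_ker_inf hp x).aestronglyMeasurable, lt_of_le_of_lt (lintegral_mono fun ω => ?_)
    (D.TT_Einf_lt_top hs x)⟩
  exact D.ker_le hp x (fun r hr hrs y => D.vinf_le hr (Adm_mono hrs.le hp) y)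
    (fun r hr hrs y => D.vinf_le hr (Adm_mono hrs.le hp) y) ω

lemma meas_maj (D : Dat C f a) (s : ℝ) (x : Euc d) : Measurable (fun ω : ℝ × Euc d × Euc d =>
    kmaj C s x ω * Einf C f ω.1 ω.2.1 * Einf C f ω.1 ω.2.2) := by
  have h1 : Measurable (fun q : ℝ × Euc d × Euc d => Einf C f q.1 q.2.1) :=
    D.mEinf.comp (f := fun q : ℝ × Euc d × Euc d => (q.1, q.2.1)) (by fun_prop)
  have h2 : Measurable (fun q : ℝ × Euc d × Euc d => Einf C f q.1 q.2.2) :=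
    D.mEinf.comp (f := fun q : ℝ × Euc d × Euc d => (q.1, q.2.2)) (by fun_prop)
  have h3 : Measurable (fun q : ℝ × Euc d × Euc d => kmaj C s x q) :=
    (measurable_kmaj C).comp (f := fun q : ℝ × Euc d × Euc d => ((s, x), q)) (by fun_prop)
  exact (h3.mul h1).mul h2

lemma fixed (D : Dat C f a) {p : PP d} {s : ℝ} (hs : 0 < s) (hp : p ∈ Adm d s) (x : Euc d) :
    vinf f p s x = Lc f p s x - BB p (vinf f p) (vinf f p) s x := by
  have hfin := D.TT_Einf_lt_top hs x
  have h1 : Tendsto (fun n => BB p (vv f n p) (vv f n p) s x) atTop (𝓝 (BB p (vinf f p) (vinf f p) s x)) := by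
    refine tendsto_integral_of_dominated_convergence
      (fun ω => (kmaj C s x ω * Einf C f ω.1 ω.2.1 * Einf C f ω.1 ω.2.2).toReal) ?_ ?_ ?_ ?_
    · exact fun n => ((MC_vv D.fm n p).ker' (MC_vv D.fm n p) p s x).aestronglyMeasurable
    · exact integrable_toReal_of_lintegral_ne_top (D.meas_maj s x).aemeasurable hfin.ne
    · intro n
      filter_upwards [ae_lt_top' (D.meas_maj s x).aemeasurable hfin.ne] with ω hω
      have := ENNReal.toReal_mono hω.ne (D.ker_le hp x
        (fun r hr hrs y => D.vv_le_Einf n hr (Adm_mono hrs.le hp) y)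
        (fun r hr hrs y => D.vv_le_Einf n hr (Adm_mono hrs.le hp) y) ω)
      simpa only [toReal_enorm] using this
    · exact ae_of_all _ fun ω => D.tendsto_ker hp x ω
  have h2 : Tendsto (fun n => vv f (n+1) p s x) atTop (𝓝 (Lc f p s x - BB p (vinf f p) (vinf f p) s x)) :=
    tendsto_const_nhds.sub h1
  exact tendsto_nhds_unique ((tendsto_add_atTop_iff_nat 1).2 (D.tendsto_vv hs hp x)) h2

lemma hol_Lc (D : Dat C f a) {s : ℝ} (hs : 0 < s) (x : Euc d) :
    DifferentiableOn ℂ (fun p => Lc f p s x) (Adm d s) := by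
  refine hol_integral (isOpen_Adm d s) (g := fun y => ENNReal.ofReal (C * Gam s (x - y)) * ‖f y‖ₑ) ?_ ?_ ?_ ?_ ?_
  · have h5 : Measurable (fun y : Euc d => ENNReal.ofReal (C * Gam s (x - y))) := by
      unfold Gam; fun_prop
    exact (h5.mul D.fm.enorm).aemeasurable
  · exact (D.n0.lt_top D.ha hs x).ne
  · exact fun y => (hol_Gc hs _).mul_const _
  · intro p hp
    have : Measurable (fun y => Gc p s (x - y)) :=
      (measurable_Gc p).comp (f := fun y : Euc d => (s, x - y)) (by fun_prop)
    exact (this.mul (Complex.measurable_ofReal.comp D.fm)).aestronglyMeasurable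
  · intro p hp y
    rw [enorm_mul]
    gcongr
    · exact D.hG p s _ hs hp
    · simp [enorm_eq_nnnorm]

lemma hol_vv (D : Dat C f a) (m : ℕ) {s : ℝ} (hs : 0 < s) (x : Euc d) :
    DifferentiableOn ℂ (fun p => vv f m p s x) (Adm d s) := by
  induction m generalizing s x with
  | zero => exact differentiableOn_const _
  | succ m ih =>
    refine (D.hol_Lc hs x).sub ?_
    refine hol_integral (isOpen_Adm d s) (g := fun ω => kmaj C s x ω * Einf C f ω.1 ω.2.1 * Einf C f ω.1 ω.2.2)
      (D.meas_maj s x).aemeasurable (D.TT_Einf_lt_top hs x).ne ?_ ?_ ?_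
    · intro ω
      by_cases hω : 0 < ω.1 ∧ ω.1 < s
      · exact ((hol_Ker x ω).mul ((ih hω.1 _).mono (Adm_mono hω.2.le))).mul
          ((ih hω.1 _).mono (Adm_mono hω.2.le))
      · have : ∀ p : PP d, Ker p s x ω = 0 := by intro p; unfold Ker; rw [if_neg hω]
        simp only [this, zero_mul]; exact differentiableOn_const _
    · exact fun p hp => ((MC_vv D.fm m p).ker' (MC_vv D.fm m p) p s x).aestronglyMeasurable
    · intro p hp ω
      exact D.ker_le hp x
        (fun r hr hrs y => D.vv_le_Einf m hr (Adm_mono hrs.le hp) y)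
        (fun r hr hrs y => D.vv_le_Einf m hr (Adm_mono hrs.le hp) y) ω

lemma hol_vinf (D : Dat C f a) {s : ℝ} (hs : 0 < s) (x : Euc d) :
    DifferentiableOn ℂ (fun p => vinf f p s x) (Adm d s) := by
  have h : DifferentiableOn ℂ (fun p => ∫ m, (vv f (m+1) p s x - vv f m p s x) ∂(Measure.count : Measure ℕ)) (Adm d s) := by
    refine hol_integral (isOpen_Adm d s) (g := fun m => DD C f m s x) (Measurable.aemeasurable (by fun_prop)) ?_ ?_ ?_ ?_
    · rw [lintegral_count]; exact (D.Einf_lt_top hs x).ne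
    · exact fun m => (D.hol_vv _ hs x).sub (D.hol_vv _ hs x)
    · exact fun p hp => (Measurable.of_discrete).aestronglyMeasurable
    · exact fun p hp m => D.ww_le m hs hp x
  refine h.congr fun p hp => ?_
  have hsum := (D.hasSum_vinf hs hp x).summable
  rw [integral_countable']
  · simp [vinf]
  · refine ⟨(Measurable.of_discrete).aestronglyMeasurable, ?_⟩
    rw [HasFiniteIntegral, lintegral_count]
    exact lt_of_le_of_lt (ENNReal.tsum_le_tsum fun m => D.ww_le m hs hp x) (D.Einf_lt_top hs x)

lemma meas_vinf (D : Dat C f a) {p : PP d} {s : ℝ} (hs : 0 < s) (hp : p ∈ Adm d s) :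
    Measurable (vinf f p s) :=
  measurable_of_tendsto_metrizable (fun n => (MC_vv D.fm n p).comp (f := fun x : Euc d => (s, x)) (by fun_prop))
    (tendsto_pi_nhds.2 fun x => D.tendsto_vv hs hp x)

end Dat
end

section

def pr {d : ℕ} (κ : Euc d) (μ : ℝ) : PP d := (fun i => (κ i : ℂ), (μ : ℂ))

lemma Gc_shift {d : ℕ} (κ : Euc d) {μ s : ℝ} (hμ : 0 < μ) (hs : 0 < s) (X : Euc d) :
    Gc (pr κ μ) s X = Gc (pr 0 1) (s * μ) (X + s • κ) := by
  unfold Gc pr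
  simp only [Complex.ofReal_one, Complex.one_cpow, mul_one, PiLp.add_apply, PiLp.smul_apply, smul_eq_mul,
    PiLp.zero_apply, Complex.ofReal_zero, mul_zero, add_zero]
  congr 1
  · rw [← mul_assoc, Real.mul_rpow (by positivity) hμ.le, ← Complex.ofReal_cpow hμ.le]
    push_cast; rfl
  · congr 2
    · push_cast; rfl
    · push_cast; ring

lemma Ker_shift {d : ℕ} (κ : Euc d) {μ s : ℝ} (hμ : 0 < μ) (x : Euc d) (r : ℝ) (y z : Euc d) :
    Ker (pr κ μ) s x (r, y, z) = μ * Ker (pr 0 1) (s * μ) (x + s • κ) (r * μ, y + r • κ, z + r • κ) := by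
  unfold Ker
  by_cases h : 0 < r ∧ r < s
  · have h' : 0 < r * μ ∧ r * μ < s * μ := ⟨mul_pos h.1 hμ, (mul_lt_mul_iff_left₀ hμ).2 h.2⟩
    simp only [h, h', and_self, if_true]
    rw [Finset.mul_sum]
    refine Finset.sum_congr rfl fun i _ => ?_
    rw [Gc_shift κ hμ (by linarith [h.2] : 0 < s - r)]
    have e1 : (s - r) * μ = s * μ - r * μ := by ring
    have e2 : x - y + (s - r) • κ = x + s • κ - (y + r • κ) := by
      rw [sub_smul]; abel
    have e3 : y + r • κ - (z + r • κ) = y - z := by abel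
    rw [e1, e2, e3, ← e1]
    have hsr : ((s:ℂ) - r) ≠ 0 := by
      have h0 : s - r ≠ 0 := by intro h0; linarith [h.2]
      rw [← Complex.ofReal_sub]; exact_mod_cast h0
    have hm : (μ:ℂ) ≠ 0 := by exact_mod_cast hμ.ne'
    have : (-(((x i - y i : ℝ) : ℂ) + ((s - r : ℝ) : ℂ) * (pr κ μ).1 i) / (2 * ((s - r : ℝ) : ℂ))) =
        μ * (-((((x + s • κ) i - (y + r • κ) i : ℝ) : ℂ) + (((s - r) * μ : ℝ) : ℂ) * (pr (0 : Euc d) 1).1 i) / (2 * (((s - r) * μ : ℝ) : ℂ))) := by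
      simp only [pr, PiLp.add_apply, PiLp.smul_apply, smul_eq_mul, PiLp.zero_apply, Complex.ofReal_zero, mul_zero, add_zero]
      push_cast
      field_simp
      ring
    rw [this]
    ring
  · have h' : ¬ (0 < r * μ ∧ r * μ < s * μ) := by
      rintro ⟨h1, h2⟩
      exact h ⟨pos_of_mul_pos_left h1 hμ.le, lt_of_mul_lt_mul_right h2 hμ.le⟩
    simp [h, h']

lemma change_var {d : ℕ} (κ : Euc d) {μ : ℝ} (hμ : 0 < μ) (F : ℝ × Euc d × Euc d → ℂ) :
    ∫ ω, F ω = μ * ∫ ω : ℝ × Euc d × Euc d, F (ω.1 * μ, ω.2.1 + ω.1 • κ, ω.2.2 + ω.1 • κ) := by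
  let e2 : ℝ × Euc d × Euc d ≃ᵐ ℝ × Euc d × Euc d :=
    { toFun := fun ω => (ω.1, ω.2.1 + ω.1 • κ, ω.2.2 + ω.1 • κ)
      invFun := fun ω => (ω.1, ω.2.1 - ω.1 • κ, ω.2.2 - ω.1 • κ)
      left_inv := fun ω => by simp
      right_inv := fun ω => by simp
      measurable_toFun := by
        show Measurable (fun ω : ℝ × Euc d × Euc d => (ω.1, ω.2.1 + ω.1 • κ, ω.2.2 + ω.1 • κ))
        fun_prop
      measurable_invFun := by
        show Measurable (fun ω : ℝ × Euc d × Euc d => (ω.1, ω.2.1 - ω.1 • κ, ω.2.2 - ω.1 • κ))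
        fun_prop }
  have hmp2 : MeasurePreserving e2 volume volume := by
    have := MeasurePreserving.skew_product (μa := (volume : Measure ℝ)) (μb := (volume : Measure ℝ))
      (μc := (volume : Measure (Euc d × Euc d))) (μd := (volume : Measure (Euc d × Euc d)))
      (f := id) (MeasurePreserving.id _)
      (g := fun r w => (w.1 + r • κ, w.2 + r • κ)) (by
        show Measurable (fun q : ℝ × Euc d × Euc d => (q.2.1 + q.1 • κ, q.2.2 + q.1 • κ))
        fun_prop) (ae_of_all _ fun r => by
          have : MeasurePreserving (fun w : Euc d × Euc d => (w.1 + r • κ, w.2 + r • κ)) volume volume :=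
            (measurePreserving_add_right volume (r • κ)).prod (measurePreserving_add_right volume (r • κ))
          exact this.map_eq)
    exact this
  let e1 : ℝ × Euc d × Euc d ≃ᵐ ℝ × Euc d × Euc d :=
    { toFun := fun ω => (ω.1 * μ, ω.2)
      invFun := fun ω => (ω.1 * μ⁻¹, ω.2)
      left_inv := fun ω => by simp [hμ.ne']
      right_inv := fun ω => by simp [hμ.ne']
      measurable_toFun := by
        show Measurable (fun ω : ℝ × Euc d × Euc d => (ω.1 * μ, ω.2))
        fun_prop
      measurable_invFun := by
        show Measurable (fun ω : ℝ × Euc d × Euc d => (ω.1 * μ⁻¹, ω.2))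
        fun_prop }
  have hm1 : Measure.map e1 volume = ENNReal.ofReal |μ⁻¹| • (volume : Measure (ℝ × Euc d × Euc d)) := by
    have h1 : (e1 : ℝ × Euc d × Euc d → ℝ × Euc d × Euc d) = Prod.map (fun r => r * μ) id := rfl
    rw [h1, Measure.volume_eq_prod, ← Measure.map_prod_map _ _ (by fun_prop) measurable_id,
      Real.map_volume_mul_right hμ.ne', Measure.map_id, Measure.prod_smul_left]
  have s1 : ∫ ω : ℝ × Euc d × Euc d, F (ω.1 * μ, ω.2.1 + ω.1 • κ, ω.2.2 + ω.1 • κ) =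
      ∫ ω : ℝ × Euc d × Euc d, F (e1 ω) := by
    rw [← hmp2.integral_comp e2.measurableEmbedding (fun ω => F (e1 ω))]
    rfl
  rw [s1, ← integral_map_equiv e1 F, hm1, integral_smul_measure]
  rw [ENNReal.toReal_ofReal (by positivity), abs_of_pos (by positivity), Complex.real_smul]
  have hm : (μ:ℂ) ≠ 0 := by exact_mod_cast hμ.ne'
  push_cast
  rw [← mul_assoc, mul_inv_cancel₀ hm, one_mul]

lemma vv_shift {d : ℕ} (f : Euc d → ℝ) (κ : Euc d) {μ : ℝ} (hμ : 0 < μ) (m : ℕ) {s : ℝ} (hs : 0 < s)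
    (x : Euc d) : vv f m (pr κ μ) s x = vv f m (pr 0 1) (s * μ) (x + s • κ) := by
  induction m generalizing s x with
  | zero => rfl
  | succ m ih =>
    have eL : Lc f (pr κ μ) s x = Lc f (pr 0 1) (s * μ) (x + s • κ) := by
      unfold Lc
      congr 1; funext y
      rw [Gc_shift κ hμ hs]
      congr 2; abel
    have eB : BB (pr κ μ) (vv f m (pr κ μ)) (vv f m (pr κ μ)) s x =
        BB (pr 0 1) (vv f m (pr 0 1)) (vv f m (pr 0 1)) (s * μ) (x + s • κ) := by
      unfold BB
      rw [change_var κ hμ (fun ω : ℝ × Euc d × Euc d => Ker (pr 0 1) (s * μ) (x + s • κ) ω * vv f m (pr 0 1) ω.1 ω.2.1 *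
        vv f m (pr 0 1) ω.1 ω.2.2), ← integral_const_mul]
      congr 1; funext ω
      obtain ⟨r, y, z⟩ := ω
      rw [Ker_shift κ hμ]
      by_cases hr : 0 < r
      · simp only
        rw [ih hr, ih hr]; ring
      · have : Ker (pr 0 1) (s * μ) (x + s • κ) (r * μ, y + r • κ, z + r • κ) = 0 := by
          unfold Ker; rw [if_neg]
          rintro ⟨h1, _⟩
          exact hr (pos_of_mul_pos_left h1 hμ.le)
        simp [this]
    show Lc f (pr κ μ) s x - _ = Lc f (pr 0 1) _ _ - _
    rw [eL, eB]

lemma vinf_shift {d : ℕ} (f : Euc d → ℝ) (κ : Euc d) {μ : ℝ} (hμ : 0 < μ) {s : ℝ} (hs : 0 < s)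
    (x : Euc d) : vinf f (pr κ μ) s x = vinf f (pr 0 1) (s * μ) (x + s • κ) := by
  unfold vinf
  simp only [vv_shift f κ hμ _ hs]

def Kr {d : ℕ} (s : ℝ) (x : Euc d) (ω : ℝ × Euc d × Euc d) : ℝ :=
  if 0 < ω.1 ∧ ω.1 < s then
    ∑ i, (-(x i - ω.2.1 i) / (2 * (s - ω.1))) *
      heatKernel d (s - ω.1) (x - ω.2.1) * Kk i (ω.2.1 - ω.2.2)
  else 0

lemma Gc_real {d : ℕ} (s : ℝ) (X : Euc d) : Gc (pr 0 1) s X = (heatKernel d s X : ℂ) := by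
  unfold Gc pr heatKernel
  simp only [Complex.ofReal_one, Complex.one_cpow, mul_one,
    PiLp.zero_apply, Complex.ofReal_zero, mul_zero, add_zero]
  rw [norm_sq_eq_sum]
  push_cast
  rfl

lemma Ker_real {d : ℕ} (s : ℝ) (x : Euc d) (ω : ℝ × Euc d × Euc d) :
    Ker (pr 0 1) s x ω = (Kr s x ω : ℂ) := by
  unfold Ker Kr
  split_ifs
  · push_cast
    refine Finset.sum_congr rfl fun i _ => ?_
    rw [Gc_real]
    simp [pr]
  · simp

lemma vv_real {d : ℕ} (f : Euc d → ℝ) (m : ℕ) (s : ℝ) (x : Euc d) :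
    vv f m (pr 0 1) s x = ((vv f m (pr 0 1) s x).re : ℂ) := by
  induction m generalizing s x with
  | zero => simp [vv]
  | succ m ih =>
    have h1 : ∃ l : ℝ, Lc f (pr 0 1) s x = (l : ℂ) := by
      refine ⟨∫ y, heatKernel d s (x - y) * f y, ?_⟩
      unfold Lc
      rw [← integral_complex_ofReal]
      congr 1; funext y; rw [Gc_real]; push_cast; rfl
    have h2 : ∃ l : ℝ, BB (pr 0 1) (vv f m (pr 0 1)) (vv f m (pr 0 1)) s x = (l : ℂ) := by
      refine ⟨∫ ω : ℝ × Euc d × Euc d, Kr s x ω * (vv f m (pr 0 1) ω.1 ω.2.1).re * (vv f m (pr 0 1) ω.1 ω.2.2).re, ?_⟩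
      unfold BB
      rw [← integral_complex_ofReal]
      congr 1; funext y; rw [Ker_real, ih, ih y.1 y.2.2]; simp
    obtain ⟨l, hl⟩ := h1
    obtain ⟨l', hl'⟩ := h2
    have : vv f (m+1) (pr 0 1) s x = ((l - l' : ℝ) : ℂ) := by
      show Lc f (pr 0 1) s x - BB _ _ _ s x = _
      rw [hl, hl']; push_cast; rfl
    rw [this]; simp

def rho {d : ℕ} (f : Euc d → ℝ) (s : ℝ) (x : Euc d) : ℝ := (vinf f (pr 0 1) s x).re

lemma vinf_real {d : ℕ} (f : Euc d → ℝ) (s : ℝ) (x : Euc d) :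
    vinf f (pr 0 1) s x = (rho f s x : ℂ) := by
  have : ∃ l : ℝ, vinf f (pr 0 1) s x = (l : ℂ) := by
    unfold vinf
    refine ⟨∑' m, ((vv f (m+1) (pr 0 1) s x).re - (vv f m (pr 0 1) s x).re), ?_⟩
    rw [Complex.ofReal_tsum]
    congr 1; funext m
    rw [vv_real, vv_real f m]; simp
  obtain ⟨l, hl⟩ := this
  unfold rho; rw [hl]; simp

lemma pr_mem {d : ℕ} (t : ℝ) : pr (0 : Euc d) 1 ∈ Adm d t := by
  constructor
  · have : (pr (0 : Euc d) 1).1 = 0 := by funext i; simp [pr]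
    rw [this]; simp
  · simp [pr]

end

section

lemma re_fderiv {X : Type*} [NormedAddCommGroup X] [NormedSpace ℝ X] {h : X → ℝ} {U : X → ℂ} {x : X}
    {U' : X →L[ℝ] ℂ} (hU : HasFDerivAt U U' x) (he : ∀ᶠ z in 𝓝 x, ((h z : ℝ) : ℂ) = U z) (v : X) :
    ((fderiv ℝ h x v : ℝ) : ℂ) = U' v := by
  have h1 : HasFDerivAt h (Complex.reCLM.comp U') x := by
    have := (Complex.reCLM.hasFDerivAt (x := U x)).comp x hU
    refine this.congr_of_eventuallyEq ?_
    filter_upwards [he] with z hz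
    simp [← hz]
  have h2 : HasFDerivAt U (Complex.ofRealCLM.comp (Complex.reCLM.comp U')) x := by
    have := (Complex.ofRealCLM.hasFDerivAt (x := h x)).comp x h1
    refine this.congr_of_eventuallyEq ?_
    filter_upwards [he] with z hz
    simp [← hz]
  rw [h1.fderiv]
  have := hU.unique h2
  rw [this]; simp

lemma re_deriv {h : ℝ → ℝ} {U : ℝ → ℂ} {x : ℝ}
    {U' : ℂ} (hU : HasDerivAt U U' x) (he : ∀ᶠ z in 𝓝 x, ((h z : ℝ) : ℂ) = U z) :
    ((deriv h x : ℝ) : ℂ) = U' := by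
  have := re_fderiv hU.hasFDerivAt he 1
  simpa using this

/-- directional derivative -/
def dirD {P X : Type*} [NormedAddCommGroup P] [NormedSpace ℂ P] (v : P) (f : P → X → ℂ) :
    P → X → ℂ := fun p x => fderiv ℂ (fun p => f p x) p v

def HolE {P X : Type*} [NormedAddCommGroup P] [NormedSpace ℂ P] (f : P → X → ℂ) (R : ℝ) : Prop :=
  ∀ R' < R, ∃ E, GoodE f R' E

section
variable {P X : Type*} [NormedAddCommGroup P] [NormedSpace ℂ P] {f : P → X → ℂ} {R : ℝ}

lemma GoodE.holE {E : X → ℝ} (h : GoodE f R E) : HolE f R := fun R' hR' =>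
  ⟨E, fun x => (h.hol x).mono (Metric.ball_subset_ball hR'.le),
    fun p hp => h.bd p (Metric.ball_subset_ball hR'.le hp)⟩

lemma HolE.diffAt (h : HolE f R) {p : P} (hp : p ∈ Metric.ball 0 R) (x : X) :
    DifferentiableAt ℂ (fun p => f p x) p := by
  have hp' : ‖p‖ < R := by simpa using hp
  obtain ⟨R', h1, h2⟩ := exists_between hp'
  obtain ⟨E, hE⟩ := h R' h2
  exact (hE.hol x).differentiableAt (Metric.isOpen_ball.mem_nhds (by simpa using h1))

lemma HolE.hasDerivAt_line (h : HolE f R) {p v : P} {w : ℂ} (hp : p + w • v ∈ Metric.ball 0 R) (x : X) :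
    HasDerivAt (fun w : ℂ => f (p + w • v) x) (dirD v f (p + w • v) x) w := by
  have h1 := (h.diffAt hp x).hasFDerivAt
  have h2 : HasDerivAt (fun w : ℂ => p + w • v) v w := by
    simpa using ((hasDerivAt_id w).smul_const v).const_add p
  exact h1.comp_hasDerivAt w h2

lemma HolE.dirD [FiniteDimensional ℂ P] (h : HolE f R) {v : P} (hv : ‖v‖ ≤ 1) : HolE (dirD v f) R := by
  intro R' hR'
  by_cases h0 : R' ≤ 0
  · refine ⟨fun _ => 0, fun x => ?_, fun p hp => ?_⟩
    · rw [Metric.ball_eq_empty.2 h0]; exact differentiableOn_empty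
    · rw [Metric.ball_eq_empty.2 h0] at hp; exact hp.elim
  push Not at h0
  obtain ⟨R'', h1, h2⟩ := exists_between hR'
  obtain ⟨E, hE⟩ := h R'' h2
  have := hE.Dv hv 1 (r := (R'' - R')/2) (by linarith) (by linarith)
  rw [show R'' - 2 * ((R'' - R')/2) = R' by ring] at this
  have heq : ∀ p ∈ Metric.ball (0:P) R', ∀ x, Dv v 1 f p x = _root_.dirD v f p x := by
    intro p hp x
    have := h.hasDerivAt_line (p := p) (v := v) (w := 0)
      (by simpa using (Metric.ball_subset_ball hR'.le hp)) x
    simp only [Dv, iteratedDeriv_one]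
    rw [this.deriv]; simp
  refine ⟨fun x => (Nat.factorial 1 : ℝ) / ((R'' - R')/2)^1 * E x, fun x => ?_, fun p hp x => ?_⟩
  · exact (this.hol x).congr fun p hp => (heq p hp x).symm
  · rw [← heq p hp x]; exact this.bd p hp x

lemma HolE.iter [FiniteDimensional ℂ P] (h : HolE f R) {v : P} (hv : ‖v‖ ≤ 1) (n : ℕ) :
    HolE ((_root_.dirD v)^[n] f) R := by
  induction n with
  | zero => simpa using h
  | succ n ih => rw [Function.iterate_succ_apply']; exact ih.dirD hv

lemma HolE.iteratedDeriv_line [FiniteDimensional ℂ P] (h : HolE f R) {v : P} (hv : ‖v‖ ≤ 1) (p : P) (x : X) (n : ℕ) :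
    ∀ w : ℂ, p + w • v ∈ Metric.ball 0 R →
      iteratedDeriv n (fun w : ℂ => f (p + w • v) x) w = (_root_.dirD v)^[n] f (p + w • v) x := by
  induction n with
  | zero => intro w hw; simp
  | succ n ih =>
    intro w hw
    rw [iteratedDeriv_succ, Function.iterate_succ_apply']
    have := (h.iter hv n).hasDerivAt_line hw x
    rw [← this.deriv]
    apply Filter.EventuallyEq.deriv_eq
    have hc : Continuous (fun w : ℂ => p + w • v) := by fun_prop
    filter_upwards [(Metric.isOpen_ball.preimage hc).mem_nhds hw] with w' hw'
    exact ih w' hw'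

lemma HolE.Dv_eq [FiniteDimensional ℂ P] (h : HolE f R) {v : P} (hv : ‖v‖ ≤ 1) {p : P}
    (hp : p ∈ Metric.ball 0 R) (x : X) (n : ℕ) : Dv v n f p x = (_root_.dirD v)^[n] f p x := by
  have := h.iteratedDeriv_line hv p x n 0 (by simpa using hp)
  simpa [Dv] using this

end

def prL (d : ℕ) : Euc d × ℝ →L[ℝ] PP d := LinearMap.toContinuousLinearMap
  { toFun := fun q => pr q.1 q.2
    map_add' := fun a b => by ext <;> simp [pr]
    map_smul' := fun a b => by ext <;> simp [pr] }

lemma prL_apply {d : ℕ} (κ : Euc d) (μ : ℝ) : prL d (κ, μ) = pr κ μ := rfl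

lemma norm_pr_le {d : ℕ} (κ : Euc d) (μ : ℝ) : ‖pr κ μ‖ ≤ max ‖κ‖ |μ| := by
  rw [Prod.norm_def]
  refine max_le_max ?_ ?_
  · rw [pi_norm_le_iff_of_nonneg (norm_nonneg _)]
    intro i
    simpa [pr] using abs_coord_le κ i
  · simp [pr]

def eS {d : ℕ} (i : Fin d) : PP d := pr (EuclideanSpace.single i 1) 0
def eT (d : ℕ) : PP d := pr (0 : Euc d) 1

lemma norm_eS {d : ℕ} (i : Fin d) : ‖eS i‖ ≤ 1 := (norm_pr_le _ _).trans (by simp)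
lemma norm_eT (d : ℕ) : ‖eT d‖ ≤ 1 := (norm_pr_le _ _).trans (by simp)

def RepH {d : ℕ} (t : ℝ) (h : Euc d → ℝ) (G : PP d → Euc d → ℂ) (c : ℂ) (R : ℝ) : Prop :=
  HolE G R ∧ ∀ x ζ, pr ζ 0 ∈ Metric.ball (0 : PP d) R → ((h (x + √t • ζ) : ℝ) : ℂ) = c * G (pr ζ 0) x

lemma RepH.pd {d : ℕ} {t : ℝ} (ht : 0 < t) {h : Euc d → ℝ} {G : PP d → Euc d → ℂ} {c : ℂ} {R : ℝ}
    (H : RepH t h G c R) (i : Fin d) : RepH t (pd i h) (dirD (eS i) G) (c * (√t : ℂ)⁻¹) R := by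
  refine ⟨H.1.dirD (norm_eS i), fun x ζ hζ => ?_⟩
  have hst : √t ≠ 0 := (Real.sqrt_pos.2 ht).ne'
  set z := x + √t • ζ with hz
  let L : Euc d →L[ℝ] PP d := (prL d).comp (ContinuousLinearMap.inl ℝ _ _)
  let A : Euc d → PP d := fun z' => L (ζ + (√t)⁻¹ • (z' - z))
  have hA : HasFDerivAt A (L.comp ((√t)⁻¹ • ContinuousLinearMap.id ℝ _)) z := by
    apply L.hasFDerivAt.comp
    exact (((hasFDerivAt_id z).sub_const z).const_smul (√t)⁻¹).const_add ζ
  have hAz : A z = pr ζ 0 := by simp [A, L, prL_apply]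
  have hG : HasFDerivAt (fun p => G p x) ((fderiv ℂ (fun p => G p x) (pr ζ 0)).restrictScalars ℝ) (A z) := by
    rw [hAz]; exact (H.1.diffAt hζ x).hasFDerivAt.restrictScalars ℝ
  have hU := (hG.comp z hA).const_mul c
  have hcA : ContinuousAt A z := hA.continuousAt
  have := re_fderiv (h := h) hU (by
    have hev : ∀ᶠ z' in 𝓝 z, A z' ∈ Metric.ball (0:PP d) R :=
      hcA (Metric.isOpen_ball.mem_nhds (by rw [hAz]; exact hζ))
    filter_upwards [hev] with z' hz'
    have h1 : A z' = pr (ζ + (√t)⁻¹ • (z' - z)) 0 := by simp [A, L, prL_apply]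
    have h2 := H.2 x (ζ + (√t)⁻¹ • (z' - z)) (by rw [← h1]; exact hz')
    rw [← h1] at h2
    simp only [Function.comp]
    rw [← h2, smul_add, smul_inv_smul₀ hst, ← add_assoc, ← hz, add_sub_cancel]) (EuclideanSpace.single i 1)
  unfold _root_.pd
  rw [this]
  simp only [ContinuousLinearMap.smul_apply, ContinuousLinearMap.comp_apply, ContinuousLinearMap.id_apply, map_smul]
  simp only [dirD, smul_eq_mul, ContinuousLinearMap.coe_restrictScalars']
  have : L (EuclideanSpace.single i 1) = eS i := by simp [L, prL_apply, eS]
  rw [this, Complex.real_smul]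
  push_cast; ring

lemma RepH.iter {d : ℕ} {t : ℝ} (ht : 0 < t) {h : Euc d → ℝ} {G : PP d → Euc d → ℂ} {c : ℂ} {R : ℝ}
    (H : RepH t h G c R) (i : Fin d) (n : ℕ) :
    RepH t ((_root_.pd i)^[n] h) ((dirD (eS i))^[n] G) (c * ((√t : ℂ)⁻¹)^n) R := by
  induction n with
  | zero => simpa using H
  | succ n ih =>
    rw [Function.iterate_succ_apply', Function.iterate_succ_apply', pow_succ, ← mul_assoc]
    exact ih.pd ht i

def RepE {d : ℕ} (t : ℝ) (h : Euc d → ℝ) (G : PP d → Euc d → ℂ) (c : ℂ) (R : ℝ) (E : Euc d → ℝ) : Prop :=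
  GoodE G R E ∧ ∀ x ζ, pr ζ 0 ∈ Metric.ball (0 : PP d) R → ((h (x + √t • ζ) : ℝ) : ℂ) = c * G (pr ζ 0) x

lemma RepE.step {d : ℕ} {t : ℝ} (ht : 0 < t) {h : Euc d → ℝ} {G : PP d → Euc d → ℂ} {c : ℂ} {R : ℝ}
    {E : Euc d → ℝ} (H : RepE t h G c R E) (i : Fin d) (n : ℕ) {r : ℝ} (hr : 0 < r) (hrR : 2 * r ≤ R) :
    RepE t ((_root_.pd i)^[n] h) (Dv (eS i) n G) (c * ((√t : ℂ)⁻¹)^n) (R - 2 * r)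
      (fun x => n.factorial / r ^ n * E x) := by
  have hE := H.1.holE
  have hsub : Metric.ball (0 : PP d) (R - 2 * r) ⊆ Metric.ball 0 R := Metric.ball_subset_ball (by linarith)
  refine ⟨H.1.Dv (norm_eS i) n hr hrR, fun x ζ hζ => ?_⟩
  rw [hE.Dv_eq (norm_eS i) (hsub hζ)]
  exact (RepH.iter ht ⟨hE, H.2⟩ i n).2 x ζ (hsub hζ)

lemma RepE.list {d : ℕ} {t : ℝ} (ht : 0 < t) (β : Fin d → ℕ) {h : Euc d → ℝ} {G : PP d → Euc d → ℂ} {c : ℂ} {R : ℝ}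
    {E : Euc d → ℝ} (H : RepE t h G c R E) {r : ℝ} (hr : 0 < r) (l : List (Fin d)) :
    2 * r * l.length ≤ R →
    ∃ G', RepE t (l.foldr (fun i g => (_root_.pd i)^[β i] g) h) G' (c * ((√t : ℂ)⁻¹)^((l.map β).sum))
      (R - 2 * r * l.length) (fun x => ((l.map (fun i => (β i).factorial)).prod : ℕ) / r ^ ((l.map β).sum) * E x) := by
  induction l with
  | nil => intro _; exact ⟨G, by simpa using H⟩
  | cons i l ih =>
    intro hl
    simp only [List.length_cons, Nat.cast_add, Nat.cast_one] at hl
    obtain ⟨G', hG'⟩ := ih (by nlinarith)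
    refine ⟨Dv (eS i) (β i) G', ?_⟩
    have := hG'.step ht i (β i) hr (by linarith)
    rw [mul_assoc, ← pow_add, show R - 2 * r * l.length - 2 * r = R - 2 * r * (i :: l).length by
      simp; ring] at this
    simp only [List.foldr_cons, List.map_cons, List.sum_cons, List.prod_cons]
    rw [add_comm (β i)]
    refine ⟨⟨this.1.hol, fun p hp x => (this.1.bd p hp x).trans (le_of_eq ?_)⟩, this.2⟩
    rw [Nat.cast_mul, pow_add]
    field_simp
end

section

def aff {d : ℕ} (t : ℝ) (p : PP d) : PP d := (((√t : ℝ) : ℂ)⁻¹ • p.1, 1 + p.2)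

def FF {d : ℕ} (f : Euc d → ℝ) (t : ℝ) (p : PP d) (x : Euc d) : ℂ := vinf f (aff t p) t x

lemma aff_mem {d : ℕ} {t : ℝ} (ht : 0 < t) {p : PP d} (hp : p ∈ Metric.ball (0 : PP d) (1/8)) :
    aff t p ∈ Adm d t := by
  have hst : 0 < √t := Real.sqrt_pos.2 ht
  have h0 : ‖p‖ < 1/8 := by simpa using hp
  have h1 : ‖p.1‖ < 1/8 := (norm_fst_le p).trans_lt h0
  have h2 : ‖p.2‖ < 1/8 := (norm_snd_le p).trans_lt h0
  refine ⟨?_, ?_⟩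
  · simp only [aff, norm_smul, norm_inv, Complex.norm_real, Real.norm_eq_abs, abs_of_pos hst]
    field_simp
    linarith
  · simpa [aff] using h2

lemma aff_pr {d : ℕ} (t : ℝ) (ζ : Euc d) (τ : ℝ) : aff t (pr ζ τ) = pr ((√t)⁻¹ • ζ) (1 + τ) := by
  ext <;> simp [aff, pr]

lemma FF_real {d : ℕ} (f : Euc d → ℝ) {t : ℝ} (ht : 0 < t) (ζ : Euc d) {τ : ℝ} (hτ : 0 < 1 + τ) (x : Euc d) :
    FF f t (pr ζ τ) x = (rho f (t * (1 + τ)) (x + √t • ζ) : ℂ) := by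
  rw [FF, aff_pr, vinf_shift f _ hτ ht, vinf_real]
  rw [smul_smul]
  have : t * (√t)⁻¹ = √t := by
    rw [← div_eq_mul_inv, Real.div_sqrt]
  rw [this]

lemma ball_pos {d : ℕ} {ζ : Euc d} {τ : ℝ} (h : pr ζ τ ∈ Metric.ball (0 : PP d) (1/8)) : 0 < 1 + τ := by
  have h0 : ‖pr ζ τ‖ < 1/8 := by simpa using h
  have h2 := (norm_snd_le (pr ζ τ)).trans_lt h0
  simp only [pr, Complex.norm_real, Real.norm_eq_abs] at h2
  linarith [(abs_lt.1 h2).1]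

variable {d : ℕ} {C : ℝ} {f : Euc d → ℝ} {a : ℝ≥0∞}

lemma Dat.goodF (D : Dat C f a) {t : ℝ} (ht : 0 < t) :
    GoodE (FF f t) (1/8) (fun x => (Einf C f t x).toReal) := by
  refine ⟨fun x => ?_, fun p hp x => ?_⟩
  · refine (D.hol_vinf ht x).comp (g := fun p => vinf f p t x) (f := aff t) ?_ (fun p hp => aff_mem ht hp)
    unfold aff
    fun_prop
  · have := ENNReal.toReal_mono (D.Einf_lt_top ht x).ne (D.vinf_le ht (aff_mem ht hp) x)
    simpa [FF] using this

lemma Dat.time_deriv (D : Dat C f a) {t : ℝ} (ht : 0 < t) (x ζ : Euc d) (k : ℕ) :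
    ∀ s, pr ζ (s / t - 1) ∈ Metric.ball (0 : PP d) (1/8) →
      ((iteratedDeriv k (fun s => rho f s (x + √t • ζ)) s : ℝ) : ℂ) =
        ((t : ℂ)⁻¹) ^ k * (dirD (eT d))^[k] (FF f t) (pr ζ (s / t - 1)) x := by
  have hF := (D.goodF ht).holE
  induction k with
  | zero =>
    intro s hs
    have := FF_real f ht ζ (ball_pos hs) x
    simp only [iteratedDeriv_zero, pow_zero, Function.iterate_zero, id, one_mul]
    rw [this]
    congr 3
    field_simp; ring
  | succ k ih =>
    intro s hs
    rw [iteratedDeriv_succ, Function.iterate_succ_apply']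
    have hH := hF.iter (norm_eT d) k
    set G := (dirD (eT d))^[k] (FF f t) with hG
    let A : ℝ → PP d := fun s => prL d (ζ, s / t - 1)
    have hA : ∀ s, HasDerivAt A (prL d (0, 1 / t)) s := by
      intro s
      apply (prL d).hasFDerivAt.comp_hasDerivAt
      exact (hasDerivAt_const s ζ).prodMk (((hasDerivAt_id s).div_const t).sub_const 1)
    have hGd : HasFDerivAt (fun p => G p x) ((fderiv ℂ (fun p => G p x) (A s)).restrictScalars ℝ) (A s) :=
      (hH.diffAt hs x).hasFDerivAt.restrictScalars ℝ
    have hU := ((hGd.comp_hasDerivAt s (hA s)).const_mul (((t : ℂ)⁻¹) ^ k))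
    rw [re_deriv hU]
    · have : prL d (0, 1 / t) = (t⁻¹ : ℝ) • eT d := by
        rw [eT, ← prL_apply, ← map_smul]; simp
      rw [this, map_smul]
      simp only [ContinuousLinearMap.coe_restrictScalars', Complex.real_smul]
      rw [pow_succ]
      show _ = _ * fderiv ℂ (fun p => G p x) (A s) (eT d)
      push_cast; ring
    · filter_upwards [(hA s).continuousAt (Metric.isOpen_ball.mem_nhds hs)] with s' hs'
      exact ih s' hs'

lemma Dat.deriv_bound (D : Dat C f a) {t : ℝ} (ht : 0 < t) (β : Fin d → ℕ) (k : ℕ) (x : Euc d) :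
    |mderiv β (tderiv k (rho f) t) x| ≤
      (t⁻¹) ^ k * ((√t)⁻¹) ^ (msize β) *
        ((∏ i, (β i).factorial : ℕ) * k.factorial / (1 / (16 * ((d:ℝ) + 2))) ^ (msize β + k)) * (Einf C f t x).toReal := by
  set r : ℝ := 1 / (16 * ((d:ℝ) + 2)) with hr
  have hr0 : 0 < r := by positivity
  have hrd : r * (16 * ((d:ℝ) + 2)) = 1 := by rw [hr]; field_simp
  have hd0 : (0:ℝ) ≤ d := Nat.cast_nonneg d
  have hF := (D.goodF ht)
  have H : RepE t (tderiv k (rho f) t) (Dv (eT d) k (FF f t)) (((t : ℂ)⁻¹) ^ k) (1/8 - 2 * r)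
      (fun x => k.factorial / r ^ k * (Einf C f t x).toReal) := by
    refine ⟨hF.Dv (norm_eT d) k hr0 (by nlinarith), fun x ζ hζ => ?_⟩
    have hζ' : pr ζ 0 ∈ Metric.ball (0 : PP d) (1/8) := Metric.ball_subset_ball (by linarith) hζ
    rw [hF.holE.Dv_eq (norm_eT d) hζ']
    have := D.time_deriv ht x ζ k t (by rw [div_self ht.ne', sub_self]; exact hζ')
    rw [div_self ht.ne', sub_self] at this
    exact this
  obtain ⟨G', hG'⟩ := H.list ht β hr0 (List.finRange d) (by rw [List.length_finRange]; nlinarith)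
  have h0 : pr (0 : Euc d) 0 ∈ Metric.ball (0 : PP d) (1/8 - 2 * r - 2 * r * (List.finRange d).length) := by
    have : pr (0 : Euc d) 0 = 0 := by ext <;> simp [pr]
    rw [this, List.length_finRange]
    apply Metric.mem_ball_self; nlinarith
  have h1 := hG'.2 x 0 h0
  have h2 := hG'.1.bd _ h0 x
  rw [smul_zero, add_zero] at h1
  have hsum : ((List.finRange d).map β).sum = msize β := by
    rw [msize, List.sum_ofFn.symm, List.ofFn_eq_map]
  have hprod : ((List.finRange d).map (fun i => (β i).factorial)).prod = ∏ i, (β i).factorial := by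
    rw [List.prod_ofFn.symm, List.ofFn_eq_map]
  rw [hsum] at h1 h2
  rw [hprod] at h2
  have h3 : |mderiv β (tderiv k (rho f) t) x| = ‖((mderiv β (tderiv k (rho f) t) x : ℝ) : ℂ)‖ := by
    simp
  rw [h3]
  unfold mderiv
  rw [h1, norm_mul, norm_mul, norm_pow, norm_pow, norm_inv, norm_inv, Complex.norm_real, Complex.norm_real,
    Real.norm_eq_abs, Real.norm_eq_abs, abs_of_pos ht, abs_of_pos (Real.sqrt_pos.2 ht), mul_assoc _ (_ / _)]
  gcongr
  refine h2.trans (le_of_eq ?_)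
  rw [pow_add]
  field_simp
end

section

lemma interp {d : ℕ} {h : Euc d → ℝ} {g : Euc d → ℝ≥0∞} {c A : ℝ≥0∞} {t : ℝ} (ht : 0 < t)
    (hc : c ≠ ⊤) (hA : A ≠ ⊤) (hh : ∀ x, ‖h x‖ₑ ≤ c * g x) (h1 : ∫⁻ x, g x ≤ A)
    (h2 : ∀ x, g x ≤ A * ENNReal.ofReal (t ^ (-(d:ℝ)/2))) {q : ℝ≥0∞} (hq : 1 ≤ q) :
    eLpNorm h q volume ≤ c * A * ENNReal.ofReal (t ^ (-(((d:ℝ)/2) * (1 - q⁻¹.toReal)))) := by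
  set B := ENNReal.ofReal (t ^ (-(d:ℝ)/2)) with hB
  by_cases hqt : q = ⊤
  · subst hqt
    simp only [eLpNorm_exponent_top, ENNReal.inv_top, ENNReal.toReal_zero, sub_zero, mul_one]
    refine eLpNormEssSup_le_of_ae_enorm_bound (ae_of_all _ fun x => ?_)
    refine (hh x).trans ?_
    rw [mul_assoc]
    gcongr
    refine (h2 x).trans ?_
    rw [hB, neg_div]
  have hq0 : q ≠ 0 := by rintro rfl; simp at hq
  rw [eLpNorm_eq_lintegral_rpow_enorm_toReal hq0 hqt]
  set p := q.toReal with hp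
  have hp1 : 1 ≤ p := by
    rw [hp, ← ENNReal.toReal_one]; exact ENNReal.toReal_mono hqt hq
  have hp0 : 0 < p := by linarith
  have hBt : B ≠ ⊤ := ENNReal.ofReal_ne_top
  have hpt : ∀ x, ‖h x‖ₑ ^ p ≤ (c ^ p * (A * B) ^ (p - 1)) * g x := by
    intro x
    calc ‖h x‖ₑ ^ p ≤ (c * g x) ^ p := by gcongr; exact hh x
      _ = c ^ p * (g x ^ (p - 1) * g x ^ (1:ℝ)) := by
        rw [ENNReal.mul_rpow_of_nonneg _ _ hp0.le, ← ENNReal.rpow_add_of_nonneg _ _ (by linarith) (by norm_num)]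
        congr 2; ring
      _ ≤ c ^ p * ((A * B) ^ (p - 1) * g x ^ (1:ℝ)) := by
        gcongr
        exact h2 x
      _ = _ := by rw [ENNReal.rpow_one, mul_assoc]
  have hK : c ^ p * (A * B) ^ (p - 1) ≠ ⊤ :=
    ENNReal.mul_ne_top (ENNReal.rpow_ne_top_of_nonneg hp0.le hc)
      (ENNReal.rpow_ne_top_of_nonneg (by linarith) (ENNReal.mul_ne_top hA hBt))
  have hint : ∫⁻ x, ‖h x‖ₑ ^ p ≤ c ^ p * A ^ p * B ^ (p - 1) := by
    calc ∫⁻ x, ‖h x‖ₑ ^ p ≤ ∫⁻ x, (c ^ p * (A * B) ^ (p - 1)) * g x := lintegral_mono hpt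
      _ = (c ^ p * (A * B) ^ (p - 1)) * ∫⁻ x, g x := lintegral_const_mul' _ _ hK
      _ ≤ (c ^ p * (A * B) ^ (p - 1)) * A := by gcongr
      _ = c ^ p * (A ^ (p - 1) * A ^ (1:ℝ)) * B ^ (p - 1) := by
        rw [ENNReal.mul_rpow_of_nonneg _ _ (by linarith), ENNReal.rpow_one]; ring
      _ = _ := by
        rw [← ENNReal.rpow_add_of_nonneg _ _ (by linarith) (by norm_num)]
        congr 3; ring
  calc (∫⁻ x, ‖h x‖ₑ ^ p) ^ (1/p) ≤ (c ^ p * A ^ p * B ^ (p - 1)) ^ (1/p) := by gcongr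
    _ = c * A * B ^ ((p - 1) * (1/p)) := by
      rw [ENNReal.mul_rpow_of_nonneg _ _ (by positivity), ENNReal.mul_rpow_of_nonneg _ _ (by positivity),
        ← ENNReal.rpow_mul, ← ENNReal.rpow_mul, ← ENNReal.rpow_mul, mul_one_div_cancel hp0.ne',
        ENNReal.rpow_one, ENNReal.rpow_one]
    _ = _ := by
      congr 1
      rw [hB, ENNReal.ofReal_rpow_of_nonneg (by positivity) (by
        have : 0 ≤ p - 1 := by linarith
        positivity), ← Real.rpow_mul ht.le]
      congr 2
      rw [ENNReal.toReal_inv, ← hp]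
      field_simp

variable {d : ℕ} {C : ℝ} {f : Euc d → ℝ} {a : ℝ≥0∞}

lemma Dat.rho_le (D : Dat C f a) {t : ℝ} (ht : 0 < t) (x : Euc d) : ‖rho f t x‖ₑ ≤ Einf C f t x := by
  have := D.vinf_le ht (pr_mem t) x
  rw [vinf_real] at this
  simpa [← ofReal_norm] using this

lemma Dat.rho_meas (D : Dat C f a) {t : ℝ} (ht : 0 < t) : Measurable (rho f t) :=
  Complex.measurable_re.comp (D.meas_vinf ht (pr_mem t))

lemma Dat.rho_Lq (D : Dat C f a) {t : ℝ} (ht : 0 < t) {q : ℝ≥0∞} (hq : 1 ≤ q) :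
    eLpNorm (rho f t) q volume ≤ 2 * a * ENNReal.ofReal (t ^ (-(((d:ℝ)/2) * (1 - q⁻¹.toReal)))) := by
  have := interp (h := rho f t) (g := Einf C f t) (c := 1) (A := 2 * a) ht (by simp)
    (by have := D.ha; finiteness) (by simpa using D.rho_le ht) (D.nEinf t ht).1 (D.nEinf t ht).2 hq
  simpa using this

lemma fact_bound {d : ℕ} (β : Fin d → ℕ) (k : ℕ) :
    (∏ i, (β i).factorial) * k.factorial ≤ (msize β + k) ^ (msize β + k) := by
  have hb : ∀ i, β i ≤ msize β + k := fun i =>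
    (Finset.single_le_sum (f := β) (fun _ _ => Nat.zero_le _) (Finset.mem_univ i)).trans (Nat.le_add_right _ _)
  have h1 : ∀ i, (β i).factorial ≤ (msize β + k) ^ (β i) := fun i =>
    (Nat.factorial_le_pow _).trans (Nat.pow_le_pow_left (hb i) _)
  have h2 : k.factorial ≤ (msize β + k) ^ k :=
    (Nat.factorial_le_pow _).trans (Nat.pow_le_pow_left (Nat.le_add_left _ _) _)
  calc _ ≤ (∏ i, (msize β + k) ^ (β i)) * (msize β + k) ^ k :=
        Nat.mul_le_mul (Finset.prod_le_prod' fun i _ => h1 i) h2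
    _ = _ := by rw [Finset.prod_pow_eq_pow_sum, pow_add, msize]

lemma Dat.analytic (D : Dat C f a) : ∃ M : ℝ, 0 < M ∧
            ∀ (β : Fin d → ℕ) (k : ℕ), 0 < msize β + k →
              ∀ q : ℝ≥0∞, 1 ≤ q → ∀ t : ℝ, 0 < t →
                eLpNorm (mderiv β (tderiv k (rho f) t)) q volume ≤
                  ENNReal.ofReal
                    (M ^ ((msize β : ℝ) + (k : ℝ)) *
                      ((msize β : ℝ) + (k : ℝ)) ^ ((msize β : ℝ) + (k : ℝ)) *
                      t ^ (-((msize β : ℝ) / 2) - (k : ℝ) -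
                            ((d : ℝ) / 2) * (1 - q⁻¹.toReal))) := by
  set r : ℝ := 1 / (16 * ((d:ℝ) + 2)) with hr
  have hr0 : 0 < r := by positivity
  have hAt : 2 * a ≠ ⊤ := by have := D.ha; finiteness
  set A := (2 * a).toReal with hA
  refine ⟨max 1 A / r, by positivity, fun β k hn q hq t ht => ?_⟩
  set n := msize β + k with hndef
  set c : ℝ := (t⁻¹) ^ k * ((√t)⁻¹) ^ (msize β) *
        ((∏ i, (β i).factorial : ℕ) * k.factorial / r ^ n) with hc
  have hc0 : 0 ≤ c := by positivity
  have hpt : ∀ x, ‖mderiv β (tderiv k (rho f) t) x‖ₑ ≤ ENNReal.ofReal c * Einf C f t x := by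
    intro x
    rw [← ENNReal.ofReal_toReal (D.Einf_lt_top ht x).ne, ← ENNReal.ofReal_mul hc0, ← ofReal_norm]
    exact ENNReal.ofReal_le_ofReal (D.deriv_bound ht β k x)
  refine (interp ht ENNReal.ofReal_ne_top hAt hpt (D.nEinf t ht).1 (D.nEinf t ht).2 hq).trans ?_
  rw [← ENNReal.ofReal_toReal hAt, ← hA, ← ENNReal.ofReal_mul hc0, ← ENNReal.ofReal_mul (by positivity)]
  apply ENNReal.ofReal_le_ofReal
  have hA0 : 0 ≤ A := ENNReal.toReal_nonneg
  have hAn : A ≤ (max 1 A) ^ n :=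
    (le_max_right 1 A).trans (le_self_pow₀ (le_max_left 1 A) hn.ne')
  have e1 : ((msize β : ℝ) + (k : ℝ)) = ((n : ℕ) : ℝ) := by rw [hndef]; push_cast; rfl
  have e2 : t ^ (-((msize β : ℝ) / 2) - (k : ℝ) - ((d : ℝ) / 2) * (1 - q⁻¹.toReal)) =
      (t⁻¹) ^ k * ((√t)⁻¹) ^ (msize β) * t ^ (-(((d:ℝ)/2) * (1 - q⁻¹.toReal))) := by
    rw [sub_eq_add_neg, Real.rpow_add ht, sub_eq_add_neg, Real.rpow_add ht, mul_comm (t ^ (-((msize β : ℝ) / 2)))]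
    congr 2
    · rw [Real.rpow_neg ht.le, Real.rpow_natCast, inv_pow]
    · rw [Real.rpow_neg ht.le, inv_pow, Real.sqrt_eq_rpow, ← Real.rpow_natCast, ← Real.rpow_mul ht.le]
      congr 2; ring
  rw [e1, e2, Real.rpow_natCast, Real.rpow_natCast, hc, div_pow]
  have hf : ((∏ i, (β i).factorial : ℕ) * k.factorial : ℝ) ≤ (n:ℝ) ^ n := by
    exact_mod_cast fact_bound β k
  set T := t ^ (-(((d:ℝ)/2) * (1 - q⁻¹.toReal)))
  calc _ = (t⁻¹) ^ k * ((√t)⁻¹) ^ (msize β) * T / r ^ n *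
        (((∏ i, (β i).factorial : ℕ) * k.factorial : ℝ) * A) := by ring
    _ ≤ (t⁻¹) ^ k * ((√t)⁻¹) ^ (msize β) * T / r ^ n * ((n:ℝ) ^ n * (max 1 A) ^ n) := by gcongr
    _ = _ := by ring

lemma Dat.time_lip (D : Dat C f a) {t : ℝ} (ht : 0 < t) {s : ℝ} (hs : |s / t - 1| < 1/16) (x : Euc d) :
    ‖rho f s x - rho f t x‖ₑ ≤ ENNReal.ofReal (32 * |s / t - 1|) * Einf C f t x := by
  set τ := s / t - 1 with hτ
  have hF := D.goodF ht
  have hsub : ∀ p ∈ Metric.ball (0 : PP d) (1/16), Metric.ball p (1/16) ⊆ Metric.ball 0 (1/8) := by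
    intro p hp q hq
    simp only [Metric.mem_ball] at *
    linarith [dist_triangle q p 0]
  have hE0 : 0 ≤ (Einf C f t x).toReal := ENNReal.toReal_nonneg
  have hfd : ∀ p ∈ Metric.ball (0 : PP d) (1/16), ‖fderiv ℂ (fun p => FF f t p x) p‖ ≤ 32 * (Einf C f t x).toReal := by
    intro p hp
    have := norm_fderiv_le_cauchy (r := 1/32) (R := 1/16) (by norm_num) (by norm_num)
      ((hF.hol x).mono (hsub p hp)) (fun q hq => hF.bd q (hsub p hp hq) x)
    refine this.trans (le_of_eq ?_); ring
  have hp0 : (0 : PP d) ∈ Metric.ball (0 : PP d) (1/16) := Metric.mem_ball_self (by norm_num)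
  have hn : ‖pr (0 : Euc d) τ‖ ≤ |τ| := (norm_pr_le _ _).trans (by simp)
  have hpτ : pr (0 : Euc d) τ ∈ Metric.ball (0 : PP d) (1/16) := by
    simpa using hn.trans_lt hs
  have hz : pr (0 : Euc d) 0 = 0 := by ext <;> simp [pr]
  have hL := (convex_ball (0 : PP d) (1/16)).norm_image_sub_le_of_norm_fderiv_le (𝕜 := ℂ)
    (f := fun p => FF f t p x) (fun p hp => (hF.hol x).differentiableAt
      (Metric.isOpen_ball.mem_nhds (hsub p hp (Metric.mem_ball_self (by norm_num))))) hfd hp0 hpτ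
  have hτ1 : 0 < 1 + τ := by linarith [(abs_lt.1 hs).1]
  have e1 := FF_real f ht 0 hτ1 x
  have e2 := FF_real f ht 0 (τ := 0) (by norm_num) x
  rw [hz] at e2
  simp only [smul_zero, add_zero, mul_one] at e1 e2
  have e3 : t * (1 + τ) = s := by rw [hτ]; field_simp; ring
  rw [e3] at e1
  simp only [e1, e2, sub_zero] at hL
  rw [← Complex.ofReal_sub, Complex.norm_real] at hL
  rw [← ENNReal.ofReal_toReal (D.Einf_lt_top ht x).ne, ← ENNReal.ofReal_mul (by positivity), ← ofReal_norm]
  apply ENNReal.ofReal_le_ofReal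
  refine hL.trans ?_
  nlinarith [abs_nonneg τ]

lemma Dat.memLp (D : Dat C f a) {t : ℝ} (ht : 0 < t) : MemLp (rho f t) 1 volume := by
  refine ⟨(D.rho_meas ht).aestronglyMeasurable, ?_⟩
  refine (D.rho_Lq ht le_rfl).trans_lt ?_
  have := D.ha
  finiteness

lemma Dat.cont (D : Dat C f a) {t : ℝ} (ht : 0 < t) :
    Tendsto (fun s => eLpNorm (fun x => rho f s x - rho f t x) 1 volume) (𝓝 t) (𝓝 0) := by
  have hAt : 2 * a ≠ ⊤ := by have := D.ha; finiteness
  have hc : Tendsto (fun s : ℝ => |s / t - 1|) (𝓝 t) (𝓝 0) := by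
    have : Continuous (fun s : ℝ => |s / t - 1|) := by fun_prop
    have h := this.tendsto t
    simpa [div_self ht.ne'] using h
  have hlim : Tendsto (fun s : ℝ => ENNReal.ofReal (32 * |s / t - 1|) * (2 * a)) (𝓝 t) (𝓝 0) := by
    have h1 : Tendsto (fun s : ℝ => ENNReal.ofReal (32 * |s / t - 1|)) (𝓝 t) (𝓝 0) := by
      have := ENNReal.tendsto_ofReal (hc.const_mul 32)
      simpa using this
    have := ENNReal.Tendsto.mul_const h1 (Or.inr hAt)
    simpa using this
  refine tendsto_of_tendsto_of_tendsto_of_le_of_le' tendsto_const_nhds hlim (Eventually.of_forall fun _ => zero_le) ?_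
  filter_upwards [hc.eventually (gt_mem_nhds (by norm_num : (0:ℝ) < 1/16))] with s hs
  rw [eLpNorm_one_eq_lintegral_enorm]
  calc _ ≤ ∫⁻ x, ENNReal.ofReal (32 * |s / t - 1|) * Einf C f t x := lintegral_mono fun x => D.time_lip ht hs x
    _ = ENNReal.ofReal (32 * |s / t - 1|) * ∫⁻ x, Einf C f t x := lintegral_const_mul' _ _ ENNReal.ofReal_ne_top
    _ ≤ _ := by gcongr; exact (D.nEinf t ht).1

lemma qd_inv {d : ℕ} (hd : 1 ≤ d) : 1 ≤ qd d ∧ (qd d)⁻¹.toReal = 1 - 1 / (2 * (d:ℝ)) := by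
  have hd' : (1:ℝ) ≤ d := by exact_mod_cast hd
  have e1 : (2 * d : ℝ≥0∞) = ENNReal.ofReal (2 * d) := by
    rw [ENNReal.ofReal_mul (by norm_num)]; simp
  have e2 : (2 * d - 1 : ℝ≥0∞) = ENNReal.ofReal (2 * d - 1) := by
    rw [e1, ENNReal.ofReal_sub _ (by norm_num)]; simp
  have e3 : qd d = ENNReal.ofReal (2 * d / (2 * d - 1)) := by
    rw [qd, e2, e1, ENNReal.ofReal_div_of_pos (by linarith)]
  have h0 : (0:ℝ) < 2 * d - 1 := by linarith
  refine ⟨?_, ?_⟩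
  · rw [e3, ← ENNReal.ofReal_one]
    apply ENNReal.ofReal_le_ofReal
    rw [le_div_iff₀ h0]; linarith
  · rw [e3, ENNReal.toReal_inv, ENNReal.toReal_ofReal (by positivity)]
    field_simp

lemma Dat.memXT (D : Dat C f a) (hd : 1 ≤ d) (T : ℝ) : MemXT d T (rho f) := by
  have hAt : 2 * a ≠ ⊤ := by have := D.ha; finiteness
  refine ⟨fun t ht => D.memLp ht.1, fun t ht => (D.cont ht.1).mono_left nhdsWithin_le_nhds,
    ⟨2 * a, hAt, fun t ht => ?_⟩, ⟨2 * a, hAt, fun t ht => ?_⟩⟩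
  · simpa using D.rho_Lq ht.1 (le_refl 1)
  · obtain ⟨h1, h2⟩ := qd_inv hd
    have := D.rho_Lq ht.1 h1
    have hd' : (1:ℝ) ≤ d := by exact_mod_cast hd
    have e : -(((d:ℝ)/2) * (1 - (qd d)⁻¹.toReal)) = -(1/4) := by
      rw [h2]; field_simp; norm_num
    rw [e] at this
    calc _ ≤ ENNReal.ofReal (t ^ (1/4 : ℝ)) * (2 * a * ENNReal.ofReal (t ^ (-(1/4) : ℝ))) := by gcongr
      _ = 2 * a * (ENNReal.ofReal (t ^ (1/4 : ℝ)) * ENNReal.ofReal (t ^ (-(1/4) : ℝ))) := by ring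
      _ = 2 * a := by
        have ht0 := ht.1
        rw [← ENNReal.ofReal_mul (by positivity), ← Real.rpow_add ht.1]; simp
      _ ≤ _ := le_rfl

end

section

lemma gradHeat_eq {d : ℕ} {τ : ℝ} (hτ : 0 < τ) (X : Euc d) :
    gradHeat d τ X = (-(heatKernel d τ X / (2 * τ))) • X := by
  unfold gradHeat
  apply HasGradientAt.gradient
  rw [hasGradientAt_iff_hasFDerivAt]
  unfold heatKernel
  have h1 : HasFDerivAt (fun x : Euc d => ‖x‖ ^ 2) (2 • (innerSL ℝ X)) X := (hasStrictFDerivAt_norm_sq X).hasFDerivAt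
  have h2 : HasFDerivAt (fun x : Euc d => -‖x‖ ^ 2 / (4 * τ)) ((4 * τ)⁻¹ • (-((2:ℕ) • (innerSL ℝ X : Euc d →L[ℝ] ℝ)))) X := by
    simpa [div_eq_mul_inv, mul_comm] using h1.neg.const_mul (4 * τ)⁻¹
  have h3 := (h2.exp).const_mul ((4 * π * τ) ^ (-(d:ℝ)/2))
  refine h3.congr_fderiv ?_
  refine ContinuousLinearMap.ext fun v => ?_
  simp [inner_smul_left]
  field_simp
  try ring

lemma not_int_one {y : Euc 1} {u : Euc 1 → ℝ} (hu : ContinuousAt u y) (hy : u y ≠ 0) :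
    ¬ Integrable (fun z => (u z / ‖y - z‖ ^ 2) • (y - z)) := by
  intro hI
  have hc : 0 < |u y| / 2 := by positivity
  have hev : ∀ᶠ z in 𝓝 y, |u y| / 2 < |u z| :=
    hu.abs.eventually (lt_mem_nhds (by have := abs_pos.2 hy; linarith))
  obtain ⟨δ, hδ, hb⟩ := Metric.eventually_nhds_iff.1 hev
  let g : ℝ → ℝ := fun r => if r < δ then r⁻¹ else 0
  have hI2 : Integrable (fun z : Euc 1 => (u (y - z) / ‖z‖ ^ 2) • z) := by
    have := hI.comp_sub_left y
    simpa using this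
  have hg : Integrable (fun z : Euc 1 => g ‖z‖) := by
    refine (hI2.norm.const_mul (|u y| / 2)⁻¹).mono' ?_ (ae_of_all _ fun z => ?_)
    · have : Measurable g := by
        refine Measurable.ite measurableSet_Iio measurable_inv measurable_const
      exact (this.comp measurable_norm).aestronglyMeasurable
    · simp only [g]
      split_ifs with h
      · have hz := hb (y := y - z) (by simpa [dist_eq_norm] using h)
        rw [norm_smul, norm_div, norm_pow, norm_norm, Real.norm_eq_abs, Real.norm_eq_abs,
          abs_of_nonneg (inv_nonneg.2 (norm_nonneg z))]
        rcases eq_or_ne ‖z‖ 0 with h0 | h0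
        · simp [h0]
        · have hz0 : 0 < ‖z‖ := lt_of_le_of_ne (norm_nonneg z) (Ne.symm h0)
          have e : |u (y - z)| / ‖z‖ ^ 2 * ‖z‖ = |u (y - z)| * ‖z‖⁻¹ := by field_simp
          rw [e, ← mul_assoc]
          refine le_mul_of_one_le_left (by positivity) ?_
          rw [inv_mul_eq_div, le_div_iff₀ hc]; linarith
      · simp only [norm_zero]; positivity
  rw [integrable_fun_norm_addHaar] at hg
  simp only [finrank_euclideanSpace, Fintype.card_fin, Nat.sub_self, pow_zero, one_smul] at hg
  have h3 : IntegrableOn (fun x : ℝ => x⁻¹) (Set.Ioc 0 (δ/2)) := by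
    refine (hg.mono_set (s := Set.Ioc 0 (δ/2)) (fun x hx => hx.1)).congr_fun ?_ measurableSet_Ioc
    intro x hx
    have : x < δ := by linarith [hx.2]
    simp [g, this]
  have h4 : IntervalIntegrable (fun x : ℝ => x⁻¹) volume 0 (δ/2) :=
    (intervalIntegrable_iff_integrableOn_Ioc_of_le (by linarith)).2 h3
  rw [intervalIntegrable_inv_iff] at h4
  rcases h4 with h4 | h4
  · linarith
  · apply h4; simp

variable {d : ℕ} {C : ℝ} {f : Euc d → ℝ} {a : ℝ≥0∞}

lemma Dat.rho_cont (D : Dat C f a) {t : ℝ} (ht : 0 < t) : Continuous (rho f t) := by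
  rw [continuous_iff_continuousAt]
  intro x
  have hst : √t ≠ 0 := (Real.sqrt_pos.2 ht).ne'
  have hz : pr (0 : Euc d) 0 = 0 := by ext <;> simp [pr]
  have h1 : ContinuousAt (fun p => FF f t p x) 0 :=
    ((D.goodF ht).hol x).continuousOn.continuousAt (Metric.ball_mem_nhds _ (by norm_num))
  have h2 : Continuous (fun z : Euc d => prL d ((√t)⁻¹ • (z - x), 0)) := by fun_prop
  have h3 : ContinuousAt (fun z : Euc d => (FF f t (prL d ((√t)⁻¹ • (z - x), 0)) x).re) x := by
    refine Complex.continuous_re.continuousAt.comp (ContinuousAt.comp (g := fun p => FF f t p x) ?_ h2.continuousAt)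
    have e : prL d ((√t)⁻¹ • (x - x), 0) = 0 := by simp [prL_apply, hz]
    rw [e]; exact h1
  refine h3.congr (Eventually.of_forall fun z => ?_)
  simp only [prL_apply]
  rw [FF_real f ht _ (by norm_num)]
  simp [smul_inv_smul₀ hst]

lemma Dat.int_K (D : Dat C f a) (hd : 2 ≤ d) {s : ℝ} (hs : 0 < s) (y : Euc d) :
    Integrable (fun z => (rho f s z / ‖y - z‖ ^ 2) • (y - z)) := by
  have hm := D.rho_meas hs
  refine ⟨Measurable.aestronglyMeasurable (by fun_prop), ?_⟩
  obtain ⟨C₃, h3, hK⟩ := exists_K_const d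
  have hEm : Measurable (Einf C f s) := D.mEinf.comp (by fun_prop : Measurable (fun x : Euc d => (s, x)))
  have := hK (Einf C f s) s (2 * a) hEm hs (D.nEinf s hs).1 (D.nEinf s hs).2 y
  refine lt_of_le_of_lt (lintegral_mono fun z => ?_) (this.trans_lt (by have := D.ha; finiteness))
  have e : ‖(rho f s z / ‖y - z‖ ^ 2) • (y - z)‖ ≤ Kn (y - z) * ‖rho f s z‖ := by
    simp only [Kn, hd, if_true]
    rw [norm_smul, norm_div, norm_pow, norm_norm]
    rcases eq_or_ne ‖y - z‖ 0 with h0 | h0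
    · simp [h0]
    · apply le_of_eq; field_simp
  calc ‖(rho f s z / ‖y - z‖ ^ 2) • (y - z)‖ₑ ≤ ENNReal.ofReal (Kn (y - z) * ‖rho f s z‖) := by
        rw [← ofReal_norm]; exact ENNReal.ofReal_le_ofReal e
    _ = ENNReal.ofReal (Kn (y - z)) * ‖rho f s z‖ₑ := by
        rw [ENNReal.ofReal_mul (by simp only [Kn, hd, if_true]; positivity), ofReal_norm]
    _ ≤ _ := by gcongr; exact D.rho_le hs z

lemma Dat.inner_eq (D : Dat C f a) (hd1 : 1 ≤ d) {s t : ℝ} (hs : 0 < s) (hst : s < t) (x y : Euc d) :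
    (inner ℝ (gradHeat d (t - s) (x - y)) (rho f s y • gradc d (rho f s) y) : ℝ) =
      ∫ z, Kr t x (s, y, z) * rho f s y * rho f s z := by
  by_cases hd : 2 ≤ d
  · have hI := D.int_K hd hs y
    have hIi : ∀ i, Integrable (fun z => (rho f s z / ‖y - z‖ ^ 2) * (y i - z i)) := fun i => by
      simpa using (EuclideanSpace.proj (𝕜 := ℝ) i).integrable_comp hI
    have hci : ∀ i, (∫ z, (rho f s z / ‖y - z‖ ^ 2) • (y - z)) i = ∫ z, (rho f s z / ‖y - z‖ ^ 2) * (y i - z i) := fun i => by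
      have := (EuclideanSpace.proj (𝕜 := ℝ) (i : Fin d)).integral_comp_comm hI
      refine this.symm.trans ?_
      simp
    rw [gradHeat_eq (by linarith)]
    have hfun : ∀ z, Kr t x (s, y, z) * rho f s y * rho f s z =
        ∑ i, ((-(x i - y i) / (2 * (t - s))) * heatKernel d (t - s) (x - y) * rho f s y * (-(1 / (d * π)))) *
          ((rho f s z / ‖y - z‖ ^ 2) * (y i - z i)) := by
      intro z
      simp only [Kr, hs, hst, and_self, if_true, Kk, hd, Finset.sum_mul]
      refine Finset.sum_congr rfl fun i _ => ?_
      simp only [PiLp.sub_apply]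
      ring
    simp_rw [hfun]
    rw [integral_finset_sum _ (fun i _ => (hIi i).const_mul _)]
    simp_rw [integral_const_mul, ← hci]
    rw [PiLp.inner_apply]
    refine Finset.sum_congr rfl fun i _ => ?_
    simp only [gradc, PiLp.smul_apply, smul_eq_mul, PiLp.sub_apply]
    simp
    ring
  · have : d = 1 := by omega
    subst this
    have h0 : ∀ z, Kr t x (s, y, z) = 0 := by
      intro z; simp [Kr, Kk]
    simp only [h0, zero_mul, integral_zero]
    by_cases hy : rho f s y = 0
    · simp [hy]
    · have := integral_undef (not_int_one (D.rho_cont hs).continuousAt hy)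
      simp [gradc, this]

lemma Dat.mild (D : Dat C f a) (hd : 1 ≤ d) {t : ℝ} (ht : 0 < t) (x : Euc d) :
    rho f t x = mildRHS d f (rho f) t x := by
  have hfix := D.fixed ht (pr_mem t) x
  have hI := D.int_ker_inf ht (pr_mem t) x
  simp only [vinf_real, Ker_real, ← Complex.ofReal_mul] at hI
  simp only [Lc, BB, vinf_real, Ker_real, Gc_real, ← Complex.ofReal_mul, integral_complex_ofReal,
    ← Complex.ofReal_sub, Complex.ofReal_inj] at hfix
  have hI' : Integrable (fun ω : ℝ × Euc d × Euc d => Kr t x ω * rho f ω.1 ω.2.1 * rho f ω.1 ω.2.2) := by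
    have := hI.re
    simpa using this
  rw [hfix, mildRHS, conv]
  congr 1
  rw [show (volume : Measure (ℝ × Euc d × Euc d)) = volume.prod volume from rfl] at hI' ⊢
  rw [integral_prod _ hI']
  have hz : ∀ s ∉ Set.Ioc (0:ℝ) t, ∫ yz : Euc d × Euc d, Kr t x (s, yz) * rho f s yz.1 * rho f s yz.2 = 0 := by
    intro s hs
    have : ∀ yz : Euc d × Euc d, Kr t x (s, yz) = 0 := by
      intro yz
      unfold Kr
      rw [if_neg]
      rintro ⟨h1, h2⟩
      exact hs ⟨h1, h2.le⟩
    simp [this]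
  rw [← setIntegral_eq_integral_of_forall_compl_eq_zero hz]
  apply setIntegral_congr_ae measurableSet_Ioc
  have hne : ∀ᵐ s : ℝ, s ≠ t := by simp [ae_iff]
  filter_upwards [hI'.prod_right_ae, hne] with s h1 h2 hs
  rw [show (volume : Measure (Euc d × Euc d)) = volume.prod volume from rfl] at h1 ⊢
  rw [integral_prod _ h1]
  refine integral_congr_ae (ae_of_all _ fun y => ?_)
  exact (D.inner_eq hd hs.1 (lt_of_le_of_ne hs.2 h2) x y).symm

end

section

lemma mildRHS_congr {d : ℕ} {f g : Euc d → ℝ} (h : f =ᵐ[volume] g) (ρ : ℝ → Euc d → ℝ) (t : ℝ) (x : Euc d) :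
    mildRHS d f ρ t x = mildRHS d g ρ t x := by
  unfold mildRHS conv
  congr 1
  refine integral_congr_ae ?_
  filter_upwards [h] with y hy
  rw [hy]

lemma exists_Dat (d : ℕ) : ∃ ε : ℝ, 0 < ε ∧ ∃ C : ℝ, ∀ f : Euc d → ℝ, Measurable f →
    ∫⁻ y, ‖f y‖ₑ ≤ ENNReal.ofReal ε → ∃ a, Dat C f a := by
  obtain ⟨C, hC, hG, hK⟩ := exists_Ker_const d
  obtain ⟨C₄, hC4, hT⟩ := T_bound d hC
  obtain ⟨C₅, hC5, h0⟩ := e0_nrm d hC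
  set K := 4 * C₄ * C₅ with hKdef
  have hKt : K ≠ ⊤ := by rw [hKdef]; finiteness
  refine ⟨(2 * (K.toReal + 1))⁻¹, by positivity, C, fun f hf hfε => ?_⟩
  refine ⟨C₅ * ∫⁻ y, ‖f y‖ₑ, hC, hG, hK, hf, h0 f hf, ?_, C₄, hC4, ?_, hT⟩
  · exact ENNReal.mul_ne_top hC5 (hfε.trans_lt ENNReal.ofReal_lt_top).ne
  · rw [← mul_assoc, ← hKdef]
    calc K * ∫⁻ y, ‖f y‖ₑ ≤ ENNReal.ofReal K.toReal * ENNReal.ofReal (2 * (K.toReal + 1))⁻¹ := by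
          rw [ENNReal.ofReal_toReal hKt]; gcongr
      _ = ENNReal.ofReal (K.toReal * (2 * (K.toReal + 1))⁻¹) := by
          rw [ENNReal.ofReal_mul ENNReal.toReal_nonneg]
      _ ≤ ENNReal.ofReal 2⁻¹ := by
          apply ENNReal.ofReal_le_ofReal
          have : 0 ≤ K.toReal := ENNReal.toReal_nonneg
          rw [mul_inv_le_iff₀ (by positivity)]; linarith
      _ = 2⁻¹ := by rw [ENNReal.ofReal_inv_of_pos (by norm_num)]; simp

end

/-- for small `L¹` initial data the mild solution is global and its
space-time derivatives satisfy the optimal decay estimate for all positive times,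
with a constant independent of `t`, `β` and `k`. -/
theorem mPKS_global_spacetime_analyticity_estimate (d : ℕ) (hd : 1 ≤ d) :
    ∃ ε : ℝ, 0 < ε ∧
      ∀ (ρ₀ : Euc d → ℝ), MemLp ρ₀ 1 volume → (∀ x, 0 ≤ ρ₀ x) →
        eLpNorm ρ₀ 1 volume ≤ ENNReal.ofReal ε →
        ∃ ρ : ℝ → Euc d → ℝ,
          (∀ T : ℝ, 0 < T → IsMildSolution d ρ₀ T ρ ∧ MemXT d T ρ) ∧
          ∃ M : ℝ, 0 < M ∧
            ∀ (β : Fin d → ℕ) (k : ℕ), 0 < msize β + k →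
              ∀ q : ℝ≥0∞, 1 ≤ q → ∀ t : ℝ, 0 < t →
                eLpNorm (mderiv β (tderiv k ρ t)) q volume ≤
                  ENNReal.ofReal
                    (M ^ ((msize β : ℝ) + (k : ℝ)) *
                      ((msize β : ℝ) + (k : ℝ)) ^ ((msize β : ℝ) + (k : ℝ)) *
                      t ^ (-((msize β : ℝ) / 2) - (k : ℝ) -
                            ((d : ℝ) / 2) * (1 - q⁻¹.toReal))) := by
  obtain ⟨ε, hε, C, hDat⟩ := exists_Dat d
  refine ⟨ε, hε, fun ρ₀ hρ _ hsmall => ?_⟩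
  have hae := hρ.1.ae_eq_mk
  set f := hρ.1.mk ρ₀
  have hfm : Measurable f := hρ.1.stronglyMeasurable_mk.measurable
  have hsm : ∫⁻ y, ‖f y‖ₑ ≤ ENNReal.ofReal ε := by
    rw [← eLpNorm_one_eq_lintegral_enorm, ← eLpNorm_congr_ae hae]; exact hsmall
  obtain ⟨a, D⟩ := hDat f hfm hsm
  refine ⟨rho f, fun T _ => ⟨fun t ht x => ?_, D.memXT hd T⟩, D.analytic⟩
  rw [mildRHS_congr hae]
  exact D.mild hd ht.1 x

end
end
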